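/- arXiv:cs/0105029 — 12 statements merged into one kernel-verified Lean document; each statement's English description precedes it below -/
import Mathlib

section
/- Let n ≥ 2, let c ≥ 0, and let v₁, v₂ be unit vectors in ℝ^n with inner product v₁·v₂ = −1/2. If r is a standard Gaussian random vector in ℝ^n, then Pr[v₁·r ≥ c and v₂·r ≥ c] ≤ N(√2·c)². -/
open MeasureTheory ProbabilityTheory

/-- The tail `N(x) = ∫_x^∞ φ(y) dy` of the standard normal distribution. -/
noncomputable def stdNormalTail (x : ℝ) : ℝ :=
  ∫ y in Set.Ioi x, (Real.sqrt (2 * Real.pi))⁻¹ * Real.exp (-(y ^ 2) / 2)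

open scoped RealInnerProductSpace

theorem stdNormalTail_eq_gaussianReal (x : ℝ) :
    stdNormalTail x = (gaussianReal 0 1).real (Set.Ici x) := by
  rw [measureReal_def, gaussianReal_apply_eq_integral 0 one_ne_zero,
    ENNReal.toReal_ofReal (integral_nonneg fun y => gaussianPDFReal_nonneg 0 1 y),
    integral_Ici_eq_integral_Ioi]
  simp [stdNormalTail, gaussianPDFReal]

section StdGaussian

variable {E : Type*} [NormedAddCommGroup E] [InnerProductSpace ℝ E] [FiniteDimensional ℝ E]
  [MeasurableSpace E] [BorelSpace E]

theorem indepFun_inner_stdGaussian {a b : E} (h : ⟪a, b⟫ = 0) :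
    IndepFun (fun r => ⟪a, r⟫) (fun r => ⟪b, r⟫) (stdGaussian E) := by
  refine HasGaussianLaw.indepFun_of_covariance_eq_zero
    (IsGaussian.hasGaussianLaw_id.map ((innerSL ℝ a).prod (innerSL ℝ b))) ?_
  rw [← covarianceBilin_apply_eq_cov IsGaussian.memLp_two_id, covarianceBilin_stdGaussian]
  exact h

theorem map_inner_stdGaussian {a : E} (h : ‖a‖ = 1) :
    (stdGaussian E).map (fun r => ⟪a, r⟫) = gaussianReal 0 1 := by
  have hL : HasGaussianLaw (innerSL ℝ a) (stdGaussian E) :=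
    IsGaussian.hasGaussianLaw_id.map (innerSL ℝ a)
  have := hL.map_eq_gaussianReal
  rw [integral_strongDual_stdGaussian, variance_dual_stdGaussian, innerSL_apply_norm, h] at this
  simpa using this

/-- Inner products of a standard Gaussian vector with two orthogonal unit vectors are independent
standard normal variables. -/
theorem stdGaussian_real_inner_ge_and_inner_ge {a b : E} (ha : ‖a‖ = 1) (hb : ‖b‖ = 1)
    (hab : ⟪a, b⟫ = 0) (x y : ℝ) :
    (stdGaussian E).real {r | x ≤ ⟪a, r⟫ ∧ y ≤ ⟪b, r⟫} = stdNormalTail x * stdNormalTail y := by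
  have key := congrArg ENNReal.toReal <|
    (indepFun_inner_stdGaussian hab).measure_inter_preimage_eq_mul (Set.Ici x) (Set.Ici y)
      measurableSet_Ici measurableSet_Ici
  rw [ENNReal.toReal_mul] at key
  rw [stdNormalTail_eq_gaussianReal, stdNormalTail_eq_gaussianReal]
  nth_rw 1 [← map_inner_stdGaussian ha]
  rw [← map_inner_stdGaussian hb,
    map_measureReal_apply (by fun_prop) measurableSet_Ici,
    map_measureReal_apply (by fun_prop) measurableSet_Ici]
  exact key

/-- The wedge cut out by two unit vectors at angle `2π/3` lies in a right-angled wedge with the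
same apex and axis. -/
theorem stdGaussian_real_inner_ge_and_inner_ge_le {u v : E} (hu : ‖u‖ = 1) (hv : ‖v‖ = 1)
    (huv : ⟪u, v⟫ = -(1 / 2)) (c : ℝ) :
    (stdGaussian E).real {r | c ≤ ⟪u, r⟫ ∧ c ≤ ⟪v, r⟫} ≤ stdNormalTail (√2 * c) ^ 2 := by
  obtain ⟨α, β, hα, hβ, hadd, hmul⟩ :
      ∃ α β : ℝ, 0 ≤ α ∧ 0 ≤ β ∧ α + β = √2 ∧ α * β = 1 / 3 := by
    have h2 : √2 ^ 2 = (2 : ℝ) := Real.sq_sqrt (by norm_num)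
    have h3 : √3 ^ 2 = (3 : ℝ) := Real.sq_sqrt (by norm_num)
    have h33 : √3 ≤ 3 := Real.sqrt_le_iff.2 (by norm_num)
    refine ⟨√2 * (3 + √3) / 6, √2 * (3 - √3) / 6, by positivity, ?_, by ring, ?_⟩
    · have : 0 ≤ 3 - √3 := by linarith
      positivity
    · linear_combination (9 - √3 ^ 2) / 36 * h2 - h3 / 18
  have hsq : α ^ 2 + β ^ 2 = 4 / 3 := by
    have h2 : √2 ^ 2 = (2 : ℝ) := Real.sq_sqrt (by norm_num)
    rw [← hadd] at h2
    linear_combination h2 - 2 * hmul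
  have hvu : ⟪v, u⟫ = -(1 / 2) := by rw [real_inner_comm, huv]
  have inner_comb (s t s' t' : ℝ) :
      ⟪s • u + t • v, s' • u + t' • v⟫ = s * s' + t * t' - (s * t' + t * s') / 2 := by
    simp only [inner_add_left, inner_add_right, real_inner_smul_left, real_inner_smul_right,
      real_inner_self_eq_norm_sq, hu, hv, huv, hvu]
    ring
  have norm_comb {s t : ℝ} (hs : s ^ 2 + t ^ 2 = 4 / 3) (ht : s * t = 1 / 3) :
      ‖s • u + t • v‖ = 1 := by
    rw [← sq_eq_sq₀ (norm_nonneg _) zero_le_one, ← real_inner_self_eq_norm_sq, inner_comb]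
    linear_combination hs - ht
  have horth : ⟪α • u + β • v, β • u + α • v⟫ = 0 := by
    rw [inner_comb]
    linear_combination 2 * hmul - hsq / 2
  rw [sq, ← stdGaussian_real_inner_ge_and_inner_ge (norm_comb hsq hmul)
    (norm_comb (by rw [add_comm, hsq]) (by rw [mul_comm, hmul])) horth]
  refine measureReal_mono ?_
  rintro r ⟨h₁, h₂⟩
  simp only [Set.mem_ofPred_eq, inner_add_left, real_inner_smul_left, ← hadd]
  constructor <;> nlinarith

end StdGaussian

theorem stmt_0 (n : ℕ) (hn : 2 ≤ n) (c : ℝ) (hc : 0 ≤ c)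
    (v₁ v₂ : Fin n → ℝ)
    (hv₁ : ∑ i, (v₁ i) ^ 2 = 1) (hv₂ : ∑ i, (v₂ i) ^ 2 = 1)
    (hv : ∑ i, v₁ i * v₂ i = -(1 / 2)) :
    ((Measure.pi fun _ : Fin n => gaussianReal 0 1)
        {r | c ≤ ∑ i, v₁ i * r i ∧ c ≤ ∑ i, v₂ i * r i}).toReal
      ≤ (stdNormalTail (Real.sqrt 2 * c)) ^ 2 := by
  have inner_toLp (x y : Fin n → ℝ) : ⟪WithLp.toLp 2 x, WithLp.toLp 2 y⟫ = ∑ i, x i * y i := by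
    simp [PiLp.inner_apply, mul_comm]
  have norm_toLp {x : Fin n → ℝ} (hx : ∑ i, x i ^ 2 = 1) : ‖WithLp.toLp 2 x‖ = 1 := by
    simp [EuclideanSpace.norm_eq, hx]
  have key := stdGaussian_real_inner_ge_and_inner_ge_le (norm_toLp hv₁) (norm_toLp hv₂)
    ((inner_toLp v₁ v₂).trans hv) c
  have hmeas : MeasurableSet {r : EuclideanSpace ℝ (Fin n) |
      c ≤ ⟪WithLp.toLp 2 v₁, r⟫ ∧ c ≤ ⟪WithLp.toLp 2 v₂, r⟫} := by
    measurability
  rw [← map_pi_eq_stdGaussian, map_measureReal_apply (by fun_prop) hmeas] at key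
  simpa only [Set.preimage_ofPred_eq, inner_toLp, measureReal_def] using key
end

section
/- Let α > 2 be a real number, let n ≥ 2, let c ≥ 0, and let v₁, v₂ be unit vectors in ℝ^n with inner product v₁·v₂ = −1/(α−1). If r is a standard Gaussian random vector in ℝ^n, then Pr[v₁·r ≥ c and v₂·r ≥ c] ≤ N(√((α−1)/(α−2))·c)². -/
open MeasureTheory ProbabilityTheory

open scoped RealInnerProductSpace

/-- The coordinates of a standard Gaussian vector along an orthonormal family form a standard
Gaussian vector. -/
theorem stdGaussian_map_inner_of_orthonormal {E κ : Type*} [NormedAddCommGroup E]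
    [InnerProductSpace ℝ E] [FiniteDimensional ℝ E] [MeasurableSpace E] [BorelSpace E]
    [Fintype κ] {w : κ → E} (hw : Orthonormal ℝ w) :
    (stdGaussian E).map (fun x => WithLp.toLp 2 fun k => ⟪w k, x⟫)
      = stdGaussian (EuclideanSpace ℝ κ) := by
  apply Measure.ext_of_charFun
  ext t
  have hinner (x : E) : ⟪WithLp.toLp 2 fun k => ⟪w k, x⟫, t⟫ = ⟪x, ∑ k, t k • w k⟫ := by
    simp [PiLp.inner_apply, inner_sum, real_inner_smul_right, real_inner_comm]
  have hnorm : ‖∑ k, t k • w k‖ ^ 2 = ‖t‖ ^ 2 := by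
    rw [EuclideanSpace.real_norm_sq_eq, ← real_inner_self_eq_norm_sq, hw.inner_sum]
    simp [sq]
  rw [charFun_apply, integral_map (by fun_prop) (by fun_prop)]
  simp_rw [hinner]
  rw [← charFun_apply, charFun_stdGaussian, charFun_stdGaussian]
  exact_mod_cast congrArg (fun s : ℝ => Complex.exp (-(s : ℂ) / 2)) hnorm

theorem gaussianReal_Ici_eq_ofReal_stdNormalTail (x : ℝ) :
    gaussianReal 0 1 (Set.Ici x) = ENNReal.ofReal (stdNormalTail x) := by
  rw [gaussianReal_apply_eq_integral 0 one_ne_zero, integral_Ici_eq_integral_Ioi]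
  simp [stdNormalTail, gaussianPDFReal]

theorem stdNormalTail_nonneg (x : ℝ) : 0 ≤ stdNormalTail x :=
  integral_nonneg fun _ => by positivity

/-- A standard Gaussian vector lies in a right-angled wedge with probability the square of the
normal tail. -/
theorem stdGaussian_orthonormal_wedge {E : Type*} [NormedAddCommGroup E]
    [InnerProductSpace ℝ E] [FiniteDimensional ℝ E] [MeasurableSpace E] [BorelSpace E]
    {w : Fin 2 → E} (hw : Orthonormal ℝ w) (c : ℝ) :
    stdGaussian E {x | ∀ k, c ≤ ⟪w k, x⟫} = ENNReal.ofReal (stdNormalTail c ^ 2) := by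
  have hmeas : MeasurableSet {y : EuclideanSpace ℝ (Fin 2) | ∀ k, c ≤ y k} := by
    simp only [Set.ofPred_forall]
    exact MeasurableSet.iInter fun k => measurableSet_le (by fun_prop) (by fun_prop)
  calc stdGaussian E {x | ∀ k, c ≤ ⟪w k, x⟫}
      = stdGaussian (EuclideanSpace ℝ (Fin 2)) {y | ∀ k, c ≤ y k} := by
        rw [← stdGaussian_map_inner_of_orthonormal hw,
          Measure.map_apply (by fun_prop) hmeas]
        rfl
    _ = Measure.pi (fun _ : Fin 2 => gaussianReal 0 1)
          (Set.univ.pi fun _ => Set.Ici c) := by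
        rw [← map_pi_eq_stdGaussian, Measure.map_apply (by fun_prop) hmeas]
        congr 1
        ext y
        simp [Pi.le_def]
    _ = ENNReal.ofReal (stdNormalTail c ^ 2) := by
        rw [Measure.pi_pi]
        simp [gaussianReal_Ici_eq_ofReal_stdNormalTail,
          ENNReal.ofReal_pow (stdNormalTail_nonneg c)]

/-- The wedge cut out by two unit vectors at an obtuse angle is contained in the right-angled
wedge with the same apex and the same axis. -/
theorem exists_orthonormal_wedge_superset {E : Type*} [NormedAddCommGroup E]
    [InnerProductSpace ℝ E] {u v : E} (hu : ‖u‖ = 1) (hv : ‖v‖ = 1) {ρ : ℝ} (hρ₀ : 0 ≤ ρ)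
    (hρ₁ : ρ < 1) (huv : ⟪u, v⟫ = -ρ) (c : ℝ) :
    ∃ w : Fin 2 → E, Orthonormal ℝ w ∧
      {x | c ≤ ⟪u, x⟫ ∧ c ≤ ⟪v, x⟫} ⊆ {x | ∀ k, (√(1 - ρ))⁻¹ * c ≤ ⟪w k, x⟫} := by
  set p := (√(1 - ρ))⁻¹ with hp
  set q := (√(1 + ρ))⁻¹ with hq
  have hp2 : p ^ 2 * (1 - ρ) = 1 := by
    rw [hp, inv_pow, Real.sq_sqrt (by linarith), inv_mul_cancel₀ (by linarith)]
  have hq2 : q ^ 2 * (1 + ρ) = 1 := by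
    rw [hq, inv_pow, Real.sq_sqrt (by linarith), inv_mul_cancel₀ (by linarith)]
  have hq₀ : 0 ≤ q := by positivity
  have hqp : q ≤ p :=
    inv_anti₀ (Real.sqrt_pos.2 (by linarith)) (Real.sqrt_le_sqrt (by linarith))
  have hvu : ⟪v, u⟫ = -ρ := by rw [real_inner_comm, huv]
  have huu : ⟪u, u⟫ = 1 := by simp [hu]
  have hvv : ⟪v, v⟫ = 1 := by simp [hv]
  refine ⟨![((p + q) / 2) • u + ((p - q) / 2) • v, ((p - q) / 2) • u + ((p + q) / 2) • v],
    ?_, ?_⟩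
  · rw [orthonormal_iff_ite]
    simp only [Fin.forall_fin_two, Matrix.cons_val_zero, Matrix.cons_val_one, inner_add_left,
      inner_add_right, real_inner_smul_left, real_inner_smul_right, huu, hvv, huv, hvu]
    norm_num
    refine ⟨⟨?_, ?_⟩, ?_, ?_⟩
    · linear_combination (hp2 + hq2) / 2
    · linear_combination (hp2 - hq2) / 2
    · linear_combination (hp2 - hq2) / 2
    · linear_combination (hp2 + hq2) / 2
  · rintro x ⟨hux, hvx⟩
    simp only [Set.mem_ofPred_eq, Fin.forall_fin_two, Matrix.cons_val_zero, Matrix.cons_val_one,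
      inner_add_left, real_inner_smul_left]
    constructor <;> nlinarith

theorem stmt_1 (α : ℝ) (hα : 2 < α) (n : ℕ) (hn : 2 ≤ n) (c : ℝ) (hc : 0 ≤ c)
    (v₁ v₂ : Fin n → ℝ)
    (hv₁ : ∑ i, (v₁ i) ^ 2 = 1) (hv₂ : ∑ i, (v₂ i) ^ 2 = 1)
    (hv : ∑ i, v₁ i * v₂ i = -(1 / (α - 1))) :
    ((Measure.pi fun _ : Fin n => gaussianReal 0 1)
        {r | c ≤ ∑ i, v₁ i * r i ∧ c ≤ ∑ i, v₂ i * r i}).toReal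
      ≤ (stdNormalTail (Real.sqrt ((α - 1) / (α - 2)) * c)) ^ 2 := by
  have hinner (u r : Fin n → ℝ) : ⟪WithLp.toLp 2 u, WithLp.toLp 2 r⟫ = ∑ i, u i * r i := by
    simp [PiLp.inner_apply, mul_comm]
  have hnorm {u : Fin n → ℝ} (hu : ∑ i, (u i) ^ 2 = 1) : ‖WithLp.toLp 2 u‖ = 1 := by
    rw [EuclideanSpace.norm_eq]
    simp [hu]
  have hscale : √((α - 1) / (α - 2)) = (√(1 - 1 / (α - 1)))⁻¹ := by
    rw [← Real.sqrt_inv, one_sub_div (by linarith), inv_div]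
    ring_nf
  obtain ⟨w, hw, hsub⟩ := exists_orthonormal_wedge_superset (hnorm hv₁) (hnorm hv₂)
    (one_div_nonneg.2 (by linarith : 0 ≤ α - 1))
    ((div_lt_one (by linarith)).2 (by linarith)) ((hinner v₁ v₂).trans hv) c
  rw [hscale]
  refine ENNReal.toReal_le_of_le_ofReal (sq_nonneg _) ?_
  rw [← stdGaussian_orthonormal_wedge hw, ← map_pi_eq_stdGaussian]
  refine le_trans (measure_mono fun r hr => ?_)
    (Measure.le_map_apply (by fun_prop) _)
  exact hsub (by simpa only [Set.mem_ofPred_eq, hinner] using hr)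
end

section
/- Let G be a finite simple graph with vertex set {1,…,n} and m edges, let v₁,…,vₙ be a vector 3-coloring of G, and let c ≥ 0. Let r be a standard Gaussian random vector in ℝ^n, let I_r = {i : vᵢ·r ≥ c}, and let e(I_r) be the number of edges of G with both endpoints in I_r. Then E[|I_r| − e(I_r)] ≥ n·N(c) − m·N(√2·c)². -/
open MeasureTheory ProbabilityTheory
open scoped Classical

theorem measureReal_gaussianReal_Ici (c : ℝ) :
    (gaussianReal 0 1).real (Set.Ici c) = stdNormalTail c := by
  rw [measureReal_def, gaussianReal_apply_eq_integral 0 one_ne_zero, ENNReal.toReal_ofReal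
    (integral_nonneg (gaussianPDFReal_nonneg 0 1)), integral_Ici_eq_integral_Ioi]
  simp [stdNormalTail, gaussianPDFReal]

/-- Two unit vectors at an angle of at least `2π/3` cut out a wedge that lies in a quadrant whose
apex is at distance `2c` from the origin. -/
theorem exists_quadrant_of_inner_le {E : Type*} [NormedAddCommGroup E]
    [InnerProductSpace ℝ E] {u w : E} (hu : ‖u‖ = 1) (hw : ‖w‖ = 1)
    (huw : inner ℝ u w ≤ -(1 / 2)) (hne : u + w ≠ 0) {c : ℝ} (hc : 0 ≤ c) :
    ∃ p q : E, ‖p‖ = 1 ∧ ‖q‖ = 1 ∧ inner ℝ p q = 0 ∧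
      ∀ z, c ≤ inner ℝ u z → c ≤ inner ℝ w z →
        √2 * c ≤ inner ℝ p z ∧ √2 * c ≤ inner ℝ q z := by
  have hA2 : ‖u + w‖ ^ 2 ≤ 1 := by rw [norm_add_sq_real, hu, hw]; linarith
  have hB2 : 1 ≤ ‖u - w‖ ^ 2 := by rw [norm_sub_sq_real, hu, hw]; linarith
  have hA : ‖u + w‖ ≤ 1 := by nlinarith [norm_nonneg (u + w)]
  have hB : 1 ≤ ‖u - w‖ := by nlinarith [norm_nonneg (u - w)]
  have hA0 : 0 < ‖u + w‖ := norm_pos_iff.2 hne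
  have hB0 : 0 < ‖u - w‖ := by linarith
  obtain ⟨A, hAdef⟩ : ∃ A, A = ‖u + w‖ := ⟨_, rfl⟩
  obtain ⟨B, hBdef⟩ : ∃ B, B = ‖u - w‖ := ⟨_, rfl⟩
  obtain ⟨s, hs⟩ : ∃ s : E, s = A⁻¹ • (u + w) := ⟨_, rfl⟩
  obtain ⟨t, ht⟩ : ∃ t : E, t = B⁻¹ • (u - w) := ⟨_, rfl⟩
  rw [← hAdef] at hA hA0
  rw [← hBdef] at hB hB0
  have hss : inner ℝ s s = (1 : ℝ) := by
    rw [hs, real_inner_smul_left, real_inner_smul_right, real_inner_self_eq_norm_sq, ← hAdef]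
    field_simp
  have htt : inner ℝ t t = (1 : ℝ) := by
    rw [ht, real_inner_smul_left, real_inner_smul_right, real_inner_self_eq_norm_sq, ← hBdef]
    field_simp
  have hst : inner ℝ s t = (0 : ℝ) := by
    rw [hs, ht, real_inner_smul_left, real_inner_smul_right,
      (real_inner_add_sub_eq_zero_iff u w).2 (hu.trans hw.symm)]
    simp
  have hts : inner ℝ t s = (0 : ℝ) := by rw [real_inner_comm, hst]
  have h2 : √2 * √2 = 2 := Real.mul_self_sqrt (by norm_num)
  have h2pos : 0 < √2 := by positivity
  have h2i : (√2)⁻¹ * (√2)⁻¹ = 1 / 2 := by rw [← mul_inv, h2]; norm_num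
  have hdiv {x : ℝ} (hx : 2 * c ≤ x) : √2 * c ≤ (√2)⁻¹ * x := by
    rw [← div_eq_inv_mul, le_div_iff₀ h2pos]
    nlinarith
  refine ⟨(√2)⁻¹ • (s + t), (√2)⁻¹ • (s - t), ?_, ?_, ?_, fun z hzu hzw ↦ ?_⟩
  · rw [← sq_eq_sq₀ (norm_nonneg _) zero_le_one, ← real_inner_self_eq_norm_sq]
    simp only [real_inner_smul_left, real_inner_smul_right, inner_add_left, inner_add_right,
      hss, htt, hst, hts]
    linarith
  · rw [← sq_eq_sq₀ (norm_nonneg _) zero_le_one, ← real_inner_self_eq_norm_sq]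
    simp only [real_inner_smul_left, real_inner_smul_right, inner_sub_left, inner_sub_right,
      hss, htt, hst, hts]
    linarith
  · simp only [real_inner_smul_left, real_inner_smul_right, inner_add_left, inner_sub_right,
      hss, htt, hst, hts]
    ring
  · have hx : A * inner ℝ s z = inner ℝ u z + inner ℝ w z := by
      rw [hs, real_inner_smul_left, inner_add_left]; field_simp
    have hy : B * inner ℝ t z = inner ℝ u z - inner ℝ w z := by
      rw [ht, real_inner_smul_left, inner_sub_left]; field_simp
    have key {x y : ℝ} (h₁ : 2 * c ≤ A * x + B * y) (h₂ : 2 * c ≤ A * x - B * y) :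
        2 * c ≤ x - |y| := by
      have hAB : 2 * c ≤ A * (x - |y|) := by
        rcases abs_cases y with ⟨h, hy⟩ | ⟨h, hy⟩ <;> rw [h] <;> nlinarith
      have : 0 ≤ x - |y| := nonneg_of_mul_nonneg_right (by linarith) hA0
      nlinarith
    have hxy := key (x := inner ℝ s z) (y := inner ℝ t z) (by linarith) (by linarith)
    simp only [real_inner_smul_left, inner_add_left, inner_sub_left]
    exact ⟨hdiv (by linarith [neg_abs_le (inner ℝ t z)]),
      hdiv (by linarith [le_abs_self (inner ℝ t z)])⟩

section StdGaussian

variable {E : Type*} [NormedAddCommGroup E] [InnerProductSpace ℝ E] [FiniteDimensional ℝ E]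
  [MeasurableSpace E] [BorelSpace E]

theorem map_inner_stdGaussian_s2 {u : E} (hu : ‖u‖ = 1) :
    (stdGaussian E).map (fun z ↦ inner ℝ u z) = gaussianReal 0 1 := by
  have h : HasGaussianLaw (innerSL ℝ u) (stdGaussian E) :=
    IsGaussian.hasGaussianLaw_id.map (innerSL ℝ u)
  have := h.map_eq_gaussianReal
  rw [integral_strongDual_stdGaussian, variance_dual_stdGaussian, innerSL_apply_norm, hu] at this
  simpa [Function.comp_def] using this

theorem stdGaussian_real_inner_ge {u : E} (hu : ‖u‖ = 1) (c : ℝ) :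
    (stdGaussian E).real {z | c ≤ inner ℝ u z} = stdNormalTail c := by
  rw [← measureReal_gaussianReal_Ici, ← map_inner_stdGaussian_s2 hu,
    map_measureReal_apply (by fun_prop) measurableSet_Ici]
  rfl

theorem indepFun_inner_stdGaussian_s2 {p q : E} (hpq : inner ℝ p q = 0) :
    IndepFun (fun z ↦ inner ℝ p z) (fun z ↦ inner ℝ q z) (stdGaussian E) := by
  have h : HasGaussianLaw (fun z : E ↦ ((innerSL ℝ p).prod (innerSL ℝ q)) z) (stdGaussian E) :=
    IsGaussian.hasGaussianLaw_id.map_fun ((innerSL ℝ p).prod (innerSL ℝ q))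
  refine HasGaussianLaw.indepFun_of_covariance_eq_zero h ?_
  rw [← covarianceBilin_apply_eq_cov IsGaussian.memLp_two_id, covarianceBilin_stdGaussian]
  exact hpq

theorem stdGaussian_real_quadrant {p q : E} (hp : ‖p‖ = 1) (hq : ‖q‖ = 1)
    (hpq : inner ℝ p q = 0) (d : ℝ) :
    (stdGaussian E).real {z | d ≤ inner ℝ p z ∧ d ≤ inner ℝ q z} = stdNormalTail d ^ 2 := by
  have h := (indepFun_inner_stdGaussian_s2 hpq).measure_inter_preimage_eq_mul
    (Set.Ici d) (Set.Ici d) measurableSet_Ici measurableSet_Ici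
  rw [sq]
  nth_rewrite 1 [← stdGaussian_real_inner_ge hp d]
  rw [← stdGaussian_real_inner_ge hq d]
  simp only [measureReal_def, ← ENNReal.toReal_mul]
  exact congrArg ENNReal.toReal h

theorem stdGaussian_real_wedge_le {u w : E} (hu : ‖u‖ = 1) (hw : ‖w‖ = 1)
    (huw : inner ℝ u w ≤ -(1 / 2)) {c : ℝ} (hc : 0 ≤ c) :
    (stdGaussian E).real {z | c ≤ inner ℝ u z ∧ c ≤ inner ℝ w z} ≤
      stdNormalTail (√2 * c) ^ 2 := by
  by_cases hne : u + w = 0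
  · have hnull : (stdGaussian E).real {z | inner ℝ u z = 0} = 0 := by
      have : ((stdGaussian E).map (fun z ↦ inner ℝ u z)).real {0} = 0 := by
        have := nullSingletonClass_gaussianReal (μ := 0) (v := 1) one_ne_zero
        rw [map_inner_stdGaussian_s2 hu, measureReal_def, measure_singleton, ENNReal.toReal_zero]
      rwa [map_measureReal_apply (by fun_prop) (measurableSet_singleton 0)] at this
    refine (measureReal_mono ?_).trans (hnull.trans_le (sq_nonneg _))
    rintro z ⟨h₁, h₂⟩
    rw [eq_neg_of_add_eq_zero_right hne, inner_neg_left] at h₂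
    exact le_antisymm (by linarith) (by linarith)
  · obtain ⟨p, q, hp, hq, hpq, hsub⟩ := exists_quadrant_of_inner_le hu hw huw hne hc
    rw [← stdGaussian_real_quadrant hp hq hpq]
    exact measureReal_mono fun z hz ↦ hsub z hz.1 hz.2

end StdGaussian

theorem inner_toLp_toLp_eq_sum {ι : Type*} [Fintype ι] (x y : ι → ℝ) :
    inner ℝ (WithLp.toLp 2 x) (WithLp.toLp 2 y) = ∑ k, x k * y k := by
  simp [PiLp.inner_apply, mul_comm]

theorem norm_toLp_eq_one {ι : Type*} [Fintype ι] {x : ι → ℝ} (hx : ∑ k, x k ^ 2 = 1) :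
    ‖WithLp.toLp 2 x‖ = 1 := by
  simp [EuclideanSpace.norm_eq, hx]

theorem pi_gaussianReal_real_halfspace {ι : Type*} [Fintype ι] {x : ι → ℝ}
    (hx : ∑ k, x k ^ 2 = 1) (c : ℝ) :
    (Measure.pi fun _ : ι ↦ gaussianReal 0 1).real {r | c ≤ ∑ k, x k * r k} =
      stdNormalTail c := by
  rw [← stdGaussian_real_inner_ge (norm_toLp_eq_one hx) c, ← map_pi_eq_stdGaussian,
    map_measureReal_apply (by fun_prop) (measurableSet_le (by fun_prop) (by fun_prop))]
  simp [inner_toLp_toLp_eq_sum]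

theorem pi_gaussianReal_real_wedge_le {ι : Type*} [Fintype ι] {x y : ι → ℝ}
    (hx : ∑ k, x k ^ 2 = 1) (hy : ∑ k, y k ^ 2 = 1) (hxy : ∑ k, x k * y k ≤ -(1 / 2))
    {c : ℝ} (hc : 0 ≤ c) :
    (Measure.pi fun _ : ι ↦ gaussianReal 0 1).real
        {r | c ≤ ∑ k, x k * r k ∧ c ≤ ∑ k, y k * r k} ≤
      stdNormalTail (√2 * c) ^ 2 := by
  rw [← inner_toLp_toLp_eq_sum] at hxy
  refine le_trans (le_of_eq ?_)
    (stdGaussian_real_wedge_le (norm_toLp_eq_one hx) (norm_toLp_eq_one hy) hxy hc)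
  rw [Set.ofPred_and, Set.ofPred_and, ← map_pi_eq_stdGaussian,
    map_measureReal_apply (by fun_prop) ((measurableSet_le (by fun_prop) (by fun_prop)).inter
      (measurableSet_le (by fun_prop) (by fun_prop)))]
  simp [inner_toLp_toLp_eq_sum]

/-- The expected number of events of a finite family that occur is the sum of the
probabilities of these events. -/
theorem integrable_and_integral_card_filter {Ω α : Type*} [MeasurableSpace Ω] (μ : Measure Ω)
    [IsFiniteMeasure μ] (s : Finset α) (P : α → Ω → Prop)
    [∀ ω, DecidablePred fun a ↦ P a ω]
    (hP : ∀ a ∈ s, MeasurableSet {ω | P a ω}) :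
    Integrable (fun ω ↦ ((s.filter fun a ↦ P a ω).card : ℝ)) μ ∧
      ∫ ω, ((s.filter fun a ↦ P a ω).card : ℝ) ∂μ = ∑ a ∈ s, μ.real {ω | P a ω} := by
  have hsum : (fun ω ↦ ((s.filter fun a ↦ P a ω).card : ℝ)) =
      fun ω ↦ ∑ a ∈ s, {ω | P a ω}.indicator (1 : Ω → ℝ) ω := by
    ext ω
    simp [Set.indicator_apply]
  have hint (a : α) (ha : a ∈ s) : Integrable ({ω | P a ω}.indicator (1 : Ω → ℝ)) μ :=
    (integrable_const (1 : ℝ)).indicator (hP a ha)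
  rw [hsum]
  refine ⟨integrable_finsetSum s hint, ?_⟩
  rw [integral_finsetSum s hint]
  exact Finset.sum_congr rfl fun a ha ↦ integral_indicator_one (hP a ha)

theorem stmt_2 (n : ℕ) (G : SimpleGraph (Fin n)) (c : ℝ) (hc : 0 ≤ c)
    (v : Fin n → (Fin n → ℝ))
    (hunit : ∀ i, ∑ k, (v i k) ^ 2 = 1)
    (hcol : ∀ i j, G.Adj i j → ∑ k, v i k * v j k ≤ -(1 / 2)) :
    (n : ℝ) * stdNormalTail c
        - (G.edgeFinset.card : ℝ) * (stdNormalTail (Real.sqrt 2 * c)) ^ 2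
      ≤ ∫ r, ((((Finset.univ.filter fun i : Fin n => c ≤ ∑ k, v i k * r k).card : ℝ))
            - (((G.edgeFinset.filter fun e => ∀ x ∈ e, c ≤ ∑ k, v x k * r k).card : ℝ)))
          ∂(Measure.pi fun _ : Fin n => gaussianReal 0 1) := by
  have hmeas (i : Fin n) : MeasurableSet {r : Fin n → ℝ | c ≤ ∑ k, v i k * r k} :=
    measurableSet_le (by fun_prop) (by fun_prop)
  have hpair (i j : Fin n) : {r : Fin n → ℝ | ∀ x ∈ s(i, j), c ≤ ∑ k, v x k * r k} =
      {r | c ≤ ∑ k, v i k * r k ∧ c ≤ ∑ k, v j k * r k} := by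
    ext r
    simp
  obtain ⟨hVint, hV⟩ := integrable_and_integral_card_filter
    (Measure.pi fun _ : Fin n ↦ gaussianReal 0 1) Finset.univ
    (fun i r ↦ c ≤ ∑ k, v i k * r k) fun i _ ↦ hmeas i
  obtain ⟨hEint, hE⟩ := integrable_and_integral_card_filter
    (Measure.pi fun _ : Fin n ↦ gaussianReal 0 1) G.edgeFinset
    (fun e r ↦ ∀ x ∈ e, c ≤ ∑ k, v x k * r k) fun e _ ↦ by
      induction e with | _ i j
      rw [hpair]
      exact (hmeas i).inter (hmeas j)
  rw [integral_sub hVint hEint, hV, hE]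
  refine sub_le_sub (le_of_eq ?_) ?_
  · simp [pi_gaussianReal_real_halfspace (hunit _)]
  · rw [← nsmul_eq_mul]
    refine Finset.sum_le_card_nsmul _ _ _ fun e he ↦ ?_
    induction e with | _ i j
    rw [hpair]
    exact pi_gaussianReal_real_wedge_le (hunit i) (hunit j)
      (hcol i j (by simpa using he)) hc
end

section
/- There exists a real number D₀ > e such that for every real D ≥ D₀, setting c = √((2/3)·ln D − (1/3)·ln ln D), one has N(c) > D·N(√2·c)². -/
open Real Set Filter Topology MeasureTheory

lemma hasDerivAt_exp_neg_sq_div_two (y : ℝ) :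
    HasDerivAt (fun y : ℝ => exp (-(y ^ 2) / 2)) (-y * exp (-(y ^ 2) / 2)) y := by
  have h : HasDerivAt (fun y : ℝ => -(y ^ 2) / 2) (-y) y := by
    refine ((hasDerivAt_pow 2 y).neg.div_const 2).congr_deriv ?_
    norm_num
    ring
  exact h.exp.congr_deriv (mul_comm _ _)

lemma tendsto_exp_neg_sq_div_two :
    Tendsto (fun y : ℝ => exp (-(y ^ 2) / 2)) atTop (𝓝 0) := by
  refine tendsto_exp_atBot.comp ?_
  have h : Tendsto (fun y : ℝ => y ^ 2 / 2) atTop atTop :=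
    (tendsto_pow_atTop two_ne_zero).atTop_div_const two_pos
  simpa only [neg_div, Function.comp_def] using tendsto_neg_atTop_atBot.comp h

lemma integrable_exp_neg_sq_div_two : Integrable (fun y : ℝ => exp (-(y ^ 2) / 2)) := by
  convert integrable_exp_neg_mul_sq (b := 1 / 2) (by norm_num) using 3
  ring

/-- The Mills ratio upper bound for the Gaussian tail. -/
lemma stdNormalTail_le {x : ℝ} (hx : 0 < x) :
    stdNormalTail x ≤ (√(2 * π))⁻¹ * (exp (-(x ^ 2) / 2) / x) := by
  have hd : ∀ y ∈ Ici x, HasDerivAt (fun y : ℝ => -exp (-(y ^ 2) / 2) / x)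
      (y / x * exp (-(y ^ 2) / 2)) y := fun y _ => by
    refine ((hasDerivAt_exp_neg_sq_div_two y).neg.div_const x).congr_deriv ?_
    ring
  have ht : Tendsto (fun y : ℝ => -exp (-(y ^ 2) / 2) / x) atTop (𝓝 0) := by
    simpa using tendsto_exp_neg_sq_div_two.neg.div_const x
  have hnn : ∀ y ∈ Ioi x, 0 ≤ y / x * exp (-(y ^ 2) / 2) := fun y hy => by
    have : 0 < y := hx.trans hy
    positivity
  have h_integral := integral_Ioi_of_hasDerivAt_of_nonneg' hd hnn ht
  rw [stdNormalTail, integral_const_mul]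
  gcongr
  calc ∫ y in Ioi x, exp (-(y ^ 2) / 2)
      ≤ ∫ y in Ioi x, y / x * exp (-(y ^ 2) / 2) := by
        refine setIntegral_mono_on integrable_exp_neg_sq_div_two.integrableOn
          (integrableOn_Ioi_deriv_of_nonneg' hd hnn ht) measurableSet_Ioi fun y hy => ?_
        exact le_mul_of_one_le_left (exp_pos _).le ((one_le_div hx).2 (le_of_lt hy))
    _ = exp (-(x ^ 2) / 2) / x := by rw [h_integral]; ring

/-- A lower bound for the Gaussian tail, within a factor two of `stdNormalTail_le`. -/
lemma le_stdNormalTail {x : ℝ} (hx : 1 ≤ x) :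
    (√(2 * π))⁻¹ * (exp (-(x ^ 2) / 2) / (2 * x)) ≤ stdNormalTail x := by
  have hd : ∀ y ∈ Ici x, HasDerivAt (fun y : ℝ => -(exp (-(y ^ 2) / 2) / (2 * y)))
      ((1 / 2 + 1 / (2 * y ^ 2)) * exp (-(y ^ 2) / 2)) y := fun y hy => by
    have hy : 0 < y := by linarith [mem_Ici.1 hy]
    refine ((hasDerivAt_exp_neg_sq_div_two y).div ((hasDerivAt_id' y).const_mul 2)
      (by positivity)).neg.congr_deriv ?_
    field_simp
    ring
  have ht : Tendsto (fun y : ℝ => -(exp (-(y ^ 2) / 2) / (2 * y))) atTop (𝓝 0) := by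
    simpa using (tendsto_exp_neg_sq_div_two.div_atTop
      (tendsto_id.const_mul_atTop (two_pos (α := ℝ)))).neg
  have hnn : ∀ y ∈ Ioi x, 0 ≤ (1 / 2 + 1 / (2 * y ^ 2)) * exp (-(y ^ 2) / 2) :=
    fun y _ => by positivity
  have h_integral := integral_Ioi_of_hasDerivAt_of_nonneg' hd hnn ht
  rw [stdNormalTail, integral_const_mul]
  gcongr
  calc exp (-(x ^ 2) / 2) / (2 * x)
      = ∫ y in Ioi x, (1 / 2 + 1 / (2 * y ^ 2)) * exp (-(y ^ 2) / 2) := by rw [h_integral]; ring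
    _ ≤ ∫ y in Ioi x, exp (-(y ^ 2) / 2) := by
        refine setIntegral_mono_on (integrableOn_Ioi_deriv_of_nonneg' hd hnn ht)
          integrable_exp_neg_sq_div_two.integrableOn measurableSet_Ioi fun y hy => ?_
        have hy : 1 ≤ y := hx.trans (le_of_lt hy)
        refine mul_le_of_le_one_left (exp_pos _).le ?_
        have : 1 / (2 * y ^ 2) ≤ 1 / 2 := by
          apply one_div_le_one_div_of_le two_pos
          nlinarith
        linarith

lemma mul_sq_stdNormalTail_lt {D c : ℝ} (hD : 0 ≤ D) (hc : 1 ≤ c)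
    (h : D * exp (-(3 * c ^ 2) / 2) < √(2 * π) * c) :
    D * stdNormalTail (√2 * c) ^ 2 < stdNormalTail c := by
  have hc0 : 0 < c := by linarith
  have hk : 0 < √(2 * π) := by positivity
  have h0 : 0 ≤ stdNormalTail (√2 * c) := integral_nonneg fun y => by positivity
  have hup := stdNormalTail_le (x := √2 * c) (by positivity)
  refine lt_of_lt_of_le ?_ (le_stdNormalTail hc)
  calc D * stdNormalTail (√2 * c) ^ 2
      ≤ D * ((√(2 * π))⁻¹ * (exp (-((√2 * c) ^ 2) / 2) / (√2 * c))) ^ 2 := by gcongr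
    _ = (D * exp (-(3 * c ^ 2) / 2)) * (exp (-(c ^ 2) / 2) / (2 * c ^ 2 * √(2 * π) ^ 2)) := by
        have he : exp (-((√2 * c) ^ 2) / 2) ^ 2
            = exp (-(3 * c ^ 2) / 2) * exp (-(c ^ 2) / 2) := by
          rw [← exp_nat_mul, ← exp_add, mul_pow, sq_sqrt zero_le_two]
          congr 1
          push_cast
          ring
        rw [mul_pow, div_pow, he, mul_pow, sq_sqrt zero_le_two]
        field_simp
    _ < (√(2 * π) * c) * (exp (-(c ^ 2) / 2) / (2 * c ^ 2 * √(2 * π) ^ 2)) := by gcongr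
    _ = (√(2 * π))⁻¹ * (exp (-(c ^ 2) / 2) / (2 * c)) := by field_simp

theorem stmt_3 : ∃ D₀ : ℝ, Real.exp 1 < D₀ ∧
    ∀ D : ℝ, D₀ ≤ D →
      D * (stdNormalTail (Real.sqrt 2 *
            Real.sqrt ((2 / 3) * Real.log D - (1 / 3) * Real.log (Real.log D)))) ^ 2
        < stdNormalTail (Real.sqrt ((2 / 3) * Real.log D - (1 / 3) * Real.log (Real.log D))) := by
  refine ⟨exp 2, exp_lt_exp.2 one_lt_two, fun D hD => ?_⟩
  have hD0 : 0 < D := (exp_pos 2).trans_le hD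
  have hL : 2 ≤ log D := (le_log_iff_exp_le hD0).2 hD
  have hL0 : 0 < log D := by linarith
  have hlog := log_le_sub_one_of_pos hL0
  set c := √((2 / 3) * log D - (1 / 3) * log (log D))
  have hc2 : c ^ 2 = (2 / 3) * log D - (1 / 3) * log (log D) := sq_sqrt (by linarith)
  have hc : 1 ≤ c := one_le_sqrt.2 (by linarith)
  refine mul_sq_stdNormalTail_lt hD0.le hc ?_
  have he : D * exp (-(3 * c ^ 2) / 2) = √(log D) := by
    rw [sqrt_eq_rpow, rpow_def_of_pos hL0, hc2]
    nth_rewrite 1 [← exp_log hD0]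
    rw [← exp_add]
    congr 1
    ring
  rw [he, sqrt_lt' (by positivity), mul_pow, sq_sqrt (by positivity)]
  nlinarith [pi_gt_three]
end

section
/- For every real α ≥ 2 there exist constants D₀(α) > 1 and c₀(α) > 0 such that the following holds: every finite simple graph G on n ≥ 1 vertices that admits a vector α-coloring and whose average degree D = 2·|E(G)|/n satisfies D ≥ D₀(α) contains an independent set of size at least c₀(α)·n/(D^(1−2/α)·(ln D)^(1/α)). -/
open MeasureTheory ProbabilityTheory Real

/-- The Gaussian tail lower-bound constant: `P(Z ≥ c) ≥ tailConst * exp (-c² / 2) / c` for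
`c ≥ 1`. -/
noncomputable def tailConst : ℝ := (√(2 * π))⁻¹ * exp (-(3 / 2))

lemma tailConst_pos : 0 < tailConst := by unfold tailConst; positivity

lemma gaussianPDFReal_zero_one (x : ℝ) :
    gaussianPDFReal 0 1 x = (√(2 * π))⁻¹ * exp (-x ^ 2 / 2) := by
  simp [gaussianPDFReal]

lemma gaussianPDFReal_zero_one_le_exp (x : ℝ) : gaussianPDFReal 0 1 x ≤ exp (-x ^ 2 / 2) := by
  rw [gaussianPDFReal_zero_one]
  refine mul_le_of_le_one_left (exp_pos _).le (inv_le_one_of_one_le₀ ?_)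
  rw [one_le_sqrt]
  linarith [pi_gt_three]

lemma tailConst_le_gaussianReal_Ici {c : ℝ} (hc : 1 ≤ c) :
    tailConst * exp (-c ^ 2 / 2) / c ≤ (gaussianReal 0 1).real (Set.Ici c) := by
  have hc0 : 0 < c := by linarith
  have hcc : c⁻¹ ≤ 1 := inv_le_one_of_one_le₀ hc
  have hsub : Set.Icc c (c + c⁻¹) ⊆ Set.Ici c := fun x hx => hx.1
  refine le_trans ?_ (measureReal_mono hsub)
  rw [Measure.real, gaussianReal_apply_eq_integral 0 one_ne_zero,
    ENNReal.toReal_ofReal (integral_nonneg fun x => gaussianPDFReal_nonneg _ _ _)]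
  have hconst : ∫ _ in Set.Icc c (c + c⁻¹), tailConst * exp (-c ^ 2 / 2)
      = tailConst * exp (-c ^ 2 / 2) / c := by
    simp [hc0.le, div_eq_inv_mul]
  rw [← hconst]
  refine setIntegral_mono_on continuousOn_const.integrableOn_Icc (integrable_gaussianPDFReal 0 1).integrableOn
    measurableSet_Icc fun x hx => ?_
  rw [gaussianPDFReal_zero_one, tailConst, mul_assoc, ← exp_add]
  gcongr
  have h1 : x ^ 2 ≤ (c + c⁻¹) ^ 2 := pow_le_pow_left₀ (by linarith [hx.1]) hx.2 2
  have h2 : (c + c⁻¹) ^ 2 = c ^ 2 + 2 + c⁻¹ ^ 2 := by field_simp; ring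
  have h3 : c⁻¹ ^ 2 ≤ 1 := pow_le_one₀ (by positivity) hcc
  linarith

lemma gaussianReal_Ici_le {x : ℝ} (hx : 0 < x) (z : ℝ) :
    gaussianReal 0 1 (Set.Ici z) ≤ ENNReal.ofReal (exp (x ^ 2 / 2 - x * z) / x) := by
  rw [gaussianReal_apply_eq_integral 0 one_ne_zero]
  apply ENNReal.ofReal_le_ofReal
  have hint : ∫ a in Set.Ioi z, exp (x ^ 2 / 2) * exp (-x * a) = exp (x ^ 2 / 2 - x * z) / x := by
    rw [integral_const_mul, integral_exp_mul_Ioi (by linarith), sub_eq_add_neg, exp_add]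
    field_simp
  rw [← hint, integral_Ici_eq_integral_Ioi]
  refine setIntegral_mono_on (integrable_gaussianPDFReal 0 1).integrableOn
    ((integrableOn_exp_mul_Ioi (by linarith) z).const_mul _) measurableSet_Ioi fun a _ => ?_
  refine (gaussianPDFReal_zero_one_le_exp a).trans ?_
  rw [← exp_add]
  gcongr
  nlinarith [sq_nonneg (a - x)]

lemma lintegral_exp_neg_mul_abs {a : ℝ} (ha : 0 < a) :
    ∫⁻ y : ℝ, ENNReal.ofReal (exp (-a * |y|)) = ENNReal.ofReal (2 / a) := by
  have hval : ∫ y : ℝ, exp (-a * |y|) = 2 / a := by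
    rw [integral_comp_abs (f := fun y => exp (-a * y)), integral_exp_mul_Ioi (by linarith)]
    simp
    ring
  rw [← hval, ofReal_integral_eq_lintegral_ofReal _ (.of_forall fun _ => (exp_pos _).le)]
  by_contra h
  rw [integral_undef h] at hval
  have : 0 < 2 / a := by positivity
  linarith

/-- A planar wedge with apex at distance `x` from the origin has Gaussian measure
`O(exp (-x² / 2) / x²)`. -/
lemma gaussianReal_prod_wedge_le {x k : ℝ} (hx : 0 < x) (hk : 0 < k) :
    ((gaussianReal 0 1).prod (gaussianReal 0 1)).real {p | x + k * |p.2| ≤ p.1}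
      ≤ 2 * exp (-x ^ 2 / 2) / (x ^ 2 * k) := by
  refine ENNReal.toReal_le_of_le_ofReal (by positivity) ?_
  rw [Measure.prod_apply_symm (measurableSet_le (by fun_prop) (by fun_prop))]
  have hC : 0 ≤ exp (-x ^ 2 / 2) / x := by positivity
  calc ∫⁻ y, gaussianReal 0 1 ((fun a => (a, y)) ⁻¹' {p : ℝ × ℝ | x + k * |p.2| ≤ p.1})
        ∂gaussianReal 0 1
      ≤ ∫⁻ y, ENNReal.ofReal (exp (-x ^ 2 / 2) / x * exp (-(x * k) * |y|)) ∂gaussianReal 0 1 := by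
        refine lintegral_mono fun y => (gaussianReal_Ici_le hx (x + k * |y|)).trans_eq ?_
        rw [div_mul_eq_mul_div, ← exp_add]
        ring_nf
    _ = ∫⁻ y, gaussianPDF 0 1 y *
          ENNReal.ofReal (exp (-x ^ 2 / 2) / x * exp (-(x * k) * |y|)) := by
        rw [gaussianReal_of_var_ne_zero 0 one_ne_zero,
          lintegral_withDensity_eq_lintegral_mul _ (measurable_gaussianPDF 0 1) (by fun_prop)]
        rfl
    _ ≤ ∫⁻ y, ENNReal.ofReal (exp (-x ^ 2 / 2) / x) *
          ENNReal.ofReal (exp (-(x * k) * |y|)) := by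
        refine lintegral_mono fun y => ?_
        rw [← ENNReal.ofReal_mul hC]
        refine mul_le_of_le_one_left' ?_
        rw [gaussianPDF, ← ENNReal.ofReal_one]
        refine ENNReal.ofReal_le_ofReal ((gaussianPDFReal_zero_one_le_exp y).trans ?_)
        rw [exp_le_one_iff]
        nlinarith [sq_nonneg y]
    _ = ENNReal.ofReal (2 * exp (-x ^ 2 / 2) / (x ^ 2 * k)) := by
        rw [lintegral_const_mul _ (by fun_prop), lintegral_exp_neg_mul_abs (by positivity),
          ← ENNReal.ofReal_mul hC]
        congr 1
        field_simp

section stdGaussian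

variable {E : Type*} [NormedAddCommGroup E] [InnerProductSpace ℝ E] [FiniteDimensional ℝ E]
  [MeasurableSpace E] [BorelSpace E]

lemma stdGaussian_map_inner {u : E} (hu : ‖u‖ = 1) :
    (stdGaussian E).map (fun r => inner ℝ u r) = gaussianReal 0 1 := by
  have h := IsGaussian.map_eq_gaussianReal (μ := stdGaussian E) (innerSL ℝ u)
  rw [variance_dual_stdGaussian, integral_strongDual_stdGaussian, innerSL_apply_norm, hu] at h
  simpa using h

lemma stdGaussian_map_inner_prod {a b : E} (ha : ‖a‖ = 1) (hb : ‖b‖ = 1)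
    (hab : inner ℝ a b = 0) :
    (stdGaussian E).map (fun r => (inner ℝ a r, inner ℝ b r))
      = (gaussianReal 0 1).prod (gaussianReal 0 1) := by
  have hlaw : HasGaussianLaw (fun r : E => (inner ℝ a r, inner ℝ b r)) (stdGaussian E) :=
    IsGaussian.hasGaussianLaw_id.map_fun ((innerSL ℝ a).prod (innerSL ℝ b))
  have hcov : cov[fun r => inner ℝ a r, fun r => inner ℝ b r; stdGaussian E] = 0 := by
    rw [← covarianceBilin_apply_eq_cov IsGaussian.memLp_two_id, covarianceBilin_stdGaussian]
    exact hab
  have hind := hlaw.indepFun_of_covariance_eq_zero hcov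
  rw [indepFun_iff_map_prod_eq_prod_map_map (by fun_prop) (by fun_prop)] at hind
  rw [hind, stdGaussian_map_inner ha, stdGaussian_map_inner hb]

lemma stdGaussian_real_inner_both_ge_le {u v : E} (hu : ‖u‖ = 1) (hv : ‖v‖ = 1)
    (huv : inner ℝ u v ≤ 0) {s : ℝ} (hs : s * ‖u + v‖ ^ 2 ≤ 2) {c : ℝ} (hc : 0 < c) :
    (stdGaussian E).real {r | c ≤ inner ℝ u r ∧ c ≤ inner ℝ v r} ≤ exp (-s * c ^ 2) / c ^ 2 := by
  have hw2 : ‖u + v‖ ^ 2 = 2 + 2 * inner ℝ u v := by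
    rw [norm_add_sq_real, hu, hv]; ring
  have hz2 : ‖u - v‖ ^ 2 = 2 - 2 * inner ℝ u v := by
    rw [norm_sub_sq_real, hu, hv]; ring
  have horth : inner ℝ (u + v) (u - v) = 0 := by
    rw [inner_add_left, inner_sub_right, inner_sub_right, real_inner_self_eq_norm_sq,
      real_inner_self_eq_norm_sq, real_inner_comm u v, hu, hv]
    ring
  set W := ‖u + v‖ with hW
  set Z := ‖u - v‖ with hZ
  have hZ0 : 0 < Z := by
    refine (norm_nonneg _).lt_of_ne' fun h => ?_
    rw [hZ, h] at hz2
    linarith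
  rcases (norm_nonneg (u + v)).eq_or_lt' with h0 | hW0
  · have hneg : v = -u := (neg_eq_of_add_eq_zero_right (norm_eq_zero.1 h0)).symm
    have hempty : {r : E | c ≤ inner ℝ u r ∧ c ≤ inner ℝ v r} = ∅ := by
      ext r
      simp only [hneg, inner_neg_left, Set.mem_ofPred_eq, Set.mem_empty_iff_false, iff_false]
      rintro ⟨h1, h2⟩
      linarith
    rw [hempty, measureReal_empty]
    positivity
  rw [← hW] at hW0
  have ha : ‖W⁻¹ • (u + v)‖ = 1 := by
    rw [norm_smul, norm_inv, norm_of_nonneg hW0.le, ← hW, inv_mul_cancel₀ hW0.ne']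
  have hb : ‖Z⁻¹ • (u - v)‖ = 1 := by
    rw [norm_smul, norm_inv, norm_of_nonneg hZ0.le, ← hZ, inv_mul_cancel₀ hZ0.ne']
  have hab : inner ℝ (W⁻¹ • (u + v)) (Z⁻¹ • (u - v)) = 0 := by
    rw [real_inner_smul_left, real_inner_smul_right, horth]; simp
  have hx : 0 < 2 * c / W := by positivity
  have hk : 0 < Z / W := by positivity
  have hwedge := gaussianReal_prod_wedge_le hx hk
  rw [← stdGaussian_map_inner_prod ha hb hab, map_measureReal_apply (by fun_prop)
    (measurableSet_le (by fun_prop) (by fun_prop))] at hwedge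
  refine (measureReal_mono fun r hr => ?_).trans (hwedge.trans ?_)
  · obtain ⟨h1, h2⟩ := hr
    simp only [Set.mem_preimage, Set.mem_ofPred_eq, real_inner_smul_left, abs_mul, abs_inv,
      abs_of_pos hZ0, inner_add_left, inner_sub_left]
    have hab' : |inner ℝ u r - inner ℝ v r| ≤ inner ℝ u r + inner ℝ v r - 2 * c :=
      abs_le.2 ⟨by linarith, by linarith⟩
    have : 2 * c / W + Z / W * (Z⁻¹ * |inner ℝ u r - inner ℝ v r|)
        = W⁻¹ * (2 * c + |inner ℝ u r - inner ℝ v r|) := by field_simp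
    rw [this]
    exact mul_le_mul_of_nonneg_left (by linarith) (by positivity)
  · have hWZ : W ^ 3 ≤ 2 * Z := by
      have hW2 : W ^ 2 ≤ 2 := by linarith
      have : W ≤ Z := by
        refine (sq_le_sq₀ hW0.le hZ0.le).1 ?_
        linarith
      nlinarith
    have hexp : exp (-(2 * c / W) ^ 2 / 2) ≤ exp (-s * c ^ 2) := by
      gcongr
      have : (2 * c / W) ^ 2 / 2 = 2 * c ^ 2 / W ^ 2 := by field_simp
      have h2 : s * c ^ 2 ≤ 2 * c ^ 2 / W ^ 2 := by
        rw [le_div_iff₀ (by positivity)]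
        nlinarith [sq_nonneg c]
      linarith
    have hden : 2 * c ^ 2 ≤ (2 * c / W) ^ 2 * (Z / W) := by
      have : (2 * c / W) ^ 2 * (Z / W) = 2 * c ^ 2 * (2 * Z / W ^ 3) := by field_simp
      rw [this]
      refine le_mul_of_one_le_right (by positivity) ?_
      rw [le_div_iff₀ (by positivity)]
      linarith
    calc 2 * exp (-(2 * c / W) ^ 2 / 2) / ((2 * c / W) ^ 2 * (Z / W))
        ≤ 2 * exp (-s * c ^ 2) / (2 * c ^ 2) := by gcongr
      _ = exp (-s * c ^ 2) / c ^ 2 := by field_simp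

end stdGaussian

namespace SimpleGraph

variable {V : Type*} [Fintype V] (G : SimpleGraph V)

open Classical in
/-- Deleting one endpoint of every edge inside `S` leaves an independent set. -/
lemma exists_independent_card_ge_sub (S : Finset V) :
    ∃ T : Finset V, (∀ i ∈ T, ∀ j ∈ T, ¬ G.Adj i j) ∧
      (S.card : ℝ) - (G.edgeFinset.filter fun e => ∀ i ∈ e, i ∈ S).card ≤ T.card := by
  set F := G.edgeFinset.filter fun e => ∀ i ∈ e, i ∈ S
  refine ⟨S \ F.image fun e => e.out.1, fun i hi j hj hij => ?_, ?_⟩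
  · rw [Finset.mem_sdiff] at hi hj
    have hF : s(i, j) ∈ F := by
      simp [F, hij, hi.1, hj.1]
    have himg := Finset.mem_image_of_mem (fun e : Sym2 V => e.out.1) hF
    rcases Sym2.mem_iff.1 (Sym2.out_fst_mem s(i, j)) with h | h
    · exact hi.2 (h ▸ himg)
    · exact hj.2 (h ▸ himg)
  · have h1 := Finset.le_card_sdiff (F.image fun e => e.out.1) S
    have h2 : (F.image fun e => e.out.1).card ≤ F.card := Finset.card_image_le
    have h3 : S.card ≤ (S \ F.image fun e => e.out.1).card + F.card := by omega
    have h4 : (S.card : ℝ) ≤ (S \ F.image fun e => e.out.1).card + F.card := by exact_mod_cast h3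
    linarith

open Classical in
/-- The alteration method: a random vertex set containing each vertex with probability at least
`p` and both ends of each edge with probability at most `q` yields an independent set of size at
least `p |V| - q |E|`. -/
lemma exists_independent_card_ge_of_random {Ω : Type*} [MeasurableSpace Ω] (μ : Measure Ω)
    [IsProbabilityMeasure μ] (A : V → Set Ω) (hA : ∀ i, MeasurableSet (A i)) {p q : ℝ}
    (hp : ∀ i, p ≤ μ.real (A i)) (hq : ∀ i j, G.Adj i j → μ.real (A i ∩ A j) ≤ q) :
    ∃ T : Finset V, (∀ i ∈ T, ∀ j ∈ T, ¬ G.Adj i j) ∧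
      Fintype.card V * p - Nat.card G.edgeSet * q ≤ T.card := by
  let B : Sym2 V → Set Ω := fun e => {ω | ∀ i ∈ e, ω ∈ A i}
  have hBmk : ∀ i j, B s(i, j) = A i ∩ A j := fun i j => by ext; simp [B]
  have hB : ∀ e, MeasurableSet (B e) := fun e => by
    induction e with
    | _ i j => rw [hBmk]; exact (hA i).inter (hA j)
  have hIA : ∀ i, Integrable ((A i).indicator (1 : Ω → ℝ)) μ :=
    fun i => (integrable_const 1).indicator (hA i)
  have hIB : ∀ e, Integrable ((B e).indicator (1 : Ω → ℝ)) μ :=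
    fun e => (integrable_const 1).indicator (hB e)
  have hS1 := integrable_finsetSum Finset.univ fun i _ => hIA i
  have hS2 := integrable_finsetSum G.edgeFinset fun e _ => hIB e
  obtain ⟨ω, hω⟩ := exists_integral_le (hS1.sub hS2)
  obtain ⟨T, hT, hcard⟩ := G.exists_independent_card_ge_sub (Finset.univ.filter fun i => ω ∈ A i)
  refine ⟨T, hT, le_trans ?_ hcard⟩
  rw [integral_sub' hS1 hS2, integral_finsetSum _ fun i _ => hIA i,
    integral_finsetSum _ fun e _ => hIB e] at hω
  simp only [integral_indicator_one (hA _), integral_indicator_one (hB _)] at hω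
  have h1 : Fintype.card V * p ≤ ∑ i, μ.real (A i) := by
    simpa using Finset.card_nsmul_le_sum Finset.univ (fun i => μ.real (A i)) p fun i _ => hp i
  have h2 : ∑ e ∈ G.edgeFinset, μ.real (B e) ≤ Nat.card G.edgeSet * q := by
    have := Finset.sum_le_card_nsmul G.edgeFinset (fun e => μ.real (B e)) q fun e he => by
      induction e with
      | _ i j => rw [hBmk]; exact hq i j (by simpa using he)
    rw [Nat.card_eq_fintype_card, ← edgeFinset_card]
    simpa using this
  have h3 : (∑ i, (A i).indicator (1 : Ω → ℝ) ω) - ∑ e ∈ G.edgeFinset, (B e).indicator (1 : Ω → ℝ) ω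
      = ((Finset.univ.filter fun i => ω ∈ A i).card : ℝ)
        - (G.edgeFinset.filter fun e => ∀ i ∈ e, i ∈ Finset.univ.filter fun i => ω ∈ A i).card := by
    simp [Set.indicator_apply, Finset.sum_boole, B]
  rw [Pi.sub_apply] at hω
  linarith

end SimpleGraph

/-- For `α > 2`, a threshold `c` balancing the Gaussian tail against the expected number of edges. -/
lemma exists_threshold {κ : ℝ} (hκ : 0 < κ) {α : ℝ} (hα : 2 < α) :
    ∃ D₀ : ℝ, 1 < D₀ ∧ ∃ c₀ : ℝ, 0 < c₀ ∧ ∀ D : ℝ, D₀ ≤ D → ∃ c : ℝ, 1 ≤ c ∧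
      c₀ / (D ^ (1 - 2 / α) * log D ^ (1 / α)) ≤
        κ * exp (-c ^ 2 / 2) / c - D / 2 * (exp (-((α - 1) / (α - 2)) * c ^ 2) / c ^ 2) := by
  obtain ⟨β, hβ⟩ : ∃ β, β = 1 - 2 / α := ⟨_, rfl⟩
  have hβ0 : 0 < β := by rw [hβ, sub_pos, div_lt_one] <;> linarith
  have hβ1 : β ≤ 1 := by
    have : 0 < 2 / α := by positivity
    linarith
  obtain ⟨M, hM⟩ : ∃ M, M = max 1 (1 / (κ * √β)) := ⟨_, rfl⟩
  have hM1 : 1 ≤ M := hM ▸ le_max_left _ _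
  have hMκ : 1 ≤ κ * √β * M := by
    have h : 1 / (κ * √β) ≤ M := hM ▸ le_max_right _ _
    rw [div_le_iff₀ (by positivity)] at h
    linarith
  have hM0 : 0 < M := by linarith
  have hexp1 : 1 < exp (1 / β) := one_lt_exp_iff.2 (by positivity)
  refine ⟨max M (exp (1 / β)), lt_max_of_lt_right hexp1, κ / 4 * M ^ (-β), by positivity,
    fun D hD => ?_⟩
  have hDM : M ≤ D := (le_max_left _ _).trans hD
  have hDe : exp (1 / β) ≤ D := (le_max_right _ _).trans hD
  have hD0 : 0 < D := by linarith
  obtain ⟨L, hL⟩ : ∃ L, L = log D := ⟨_, rfl⟩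
  have hLβ : 1 / β ≤ L := by rw [hL, le_log_iff_exp_le hD0]; exact hDe
  have hβL : 1 ≤ β * L := by rwa [div_le_iff₀' hβ0] at hLβ
  have hL0 : 0 < L := (by positivity : 0 < 1 / β).trans_le hLβ
  have hL1 : 1 ≤ L := by nlinarith
  have hMlog : log M ≤ L := hL ▸ log_le_log hM0 hDM
  have hMlog0 : 0 ≤ log M := log_nonneg hM1
  have hLlog : log L ≤ L := (log_le_sub_one_of_pos hL0).trans (by linarith)
  have hLlog0 : 0 ≤ log L := log_nonneg hL1
  obtain ⟨Y, hY⟩ : ∃ Y, Y = log M + L - log L / 2 := ⟨_, rfl⟩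
  have hYlo : L / 2 ≤ Y := by linarith
  have hYhi : Y ≤ 2 * L := by linarith
  have hexpY : exp Y = M * D / √L := by
    rw [hY, exp_sub, exp_add, exp_log hM0, hL, exp_log hD0, ← log_sqrt (hL ▸ hL0.le),
      exp_log (sqrt_pos.2 (hL ▸ hL0))]
  have hc2 : √(2 * β * Y) ^ 2 = 2 * β * Y := sq_sqrt (by nlinarith)
  have hclo : √β * √L ≤ √(2 * β * Y) := by
    rw [← sqrt_mul hβ0.le]
    apply sqrt_le_sqrt
    nlinarith
  have hchi : √(2 * β * Y) ≤ 2 * √L := by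
    rw [sqrt_le_left (by positivity), mul_pow, sq_sqrt hL0.le]
    nlinarith
  have hc1 : 1 ≤ √(2 * β * Y) := by
    rw [one_le_sqrt]
    nlinarith
  refine ⟨√(2 * β * Y), hc1, ?_⟩
  obtain ⟨c, hc⟩ : ∃ c, c = √(2 * β * Y) := ⟨_, rfl⟩
  rw [← hc] at hc2 hclo hchi hc1 ⊢
  have hc0 : 0 < c := by linarith
  have hsL : 0 < √L := sqrt_pos.2 hL0
  have hcY : c ^ 2 / 2 = β * Y := by linarith
  have hsplit : -((α - 1) / (α - 2)) * c ^ 2 = -c ^ 2 / 2 - Y := by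
    have hs : (α - 1) / (α - 2) = 1 / 2 + 1 / (2 * β) := by
      have h1 : α - 2 ≠ 0 := by linarith
      have h2 : α ≠ 0 := by linarith
      have h3 : 1 - 2 / α ≠ 0 := hβ ▸ hβ0.ne'
      have h4 : 1 - 2 / α = (α - 2) / α := by field_simp
      rw [hβ, h4]
      field_simp
      ring
    rw [hs, hc2]
    field_simp
    ring
  have hedge : D / 2 * (exp (-((α - 1) / (α - 2)) * c ^ 2) / c ^ 2)
      ≤ κ * exp (-c ^ 2 / 2) / c / 2 := by
    have hkey : D ≤ κ * c * exp Y := by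
      rw [hexpY]
      calc D ≤ (κ * √β * M) * D := le_mul_of_one_le_left hD0.le hMκ
        _ = κ * (√β * √L) * (M * D / √L) := by field_simp
        _ ≤ κ * c * (M * D / √L) := by gcongr
    rw [hsplit, exp_sub]
    calc D / 2 * (exp (-c ^ 2 / 2) / exp Y / c ^ 2)
        ≤ κ * c * exp Y / 2 * (exp (-c ^ 2 / 2) / exp Y / c ^ 2) := by gcongr
      _ = κ * exp (-c ^ 2 / 2) / c / 2 := by field_simp
  have hmain : κ / 4 * M ^ (-β) / (D ^ (1 - 2 / α) * log D ^ (1 / α))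
      ≤ κ * exp (-c ^ 2 / 2) / c / 2 := by
    have hpow : exp (-c ^ 2 / 2) = M ^ (-β) * (D ^ (-β) * L ^ (β / 2)) := by
      rw [rpow_def_of_pos hM0, rpow_def_of_pos hD0, rpow_def_of_pos hL0, ← exp_add, ← exp_add,
        neg_div, hcY, hY, ← hL]
      congr 1
      ring
    have hα' : 1 / α = 1 / 2 - β / 2 := by rw [hβ]; ring
    have hLpow : L ^ (1 / α) * L ^ (β / 2) = √L := by
      rw [← rpow_add hL0, hα', sqrt_eq_rpow]
      congr 1
      ring
    rw [← hβ, ← hL, hpow, rpow_neg hD0.le]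
    have hDβ : 0 < D ^ β := rpow_pos_of_pos hD0 _
    have hLα : 0 < L ^ (1 / α) := rpow_pos_of_pos hL0 _
    have hLβ2 : 0 < L ^ (β / 2) := rpow_pos_of_pos hL0 _
    have hMβ : 0 < M ^ (-β) := rpow_pos_of_pos hM0 _
    calc κ / 4 * M ^ (-β) / (D ^ β * L ^ (1 / α))
        = κ * (M ^ (-β) * ((D ^ β)⁻¹ * L ^ (β / 2))) / (2 * (L ^ (1 / α) * L ^ (β / 2))) / 2 := by
          field_simp
          norm_num
      _ ≤ κ * (M ^ (-β) * ((D ^ β)⁻¹ * L ^ (β / 2))) / c / 2 := by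
          rw [hLpow]
          gcongr
  linarith

lemma exists_independent_card_ge_of_unit_vectors {n : ℕ} (G : SimpleGraph (Fin n))
    {E : Type*} [NormedAddCommGroup E] [InnerProductSpace ℝ E] [FiniteDimensional ℝ E]
    [MeasurableSpace E] [BorelSpace E] (v : Fin n → E) (hv : ∀ i, ‖v i‖ = 1)
    (hinner : ∀ i j, G.Adj i j → inner ℝ (v i) (v j) ≤ 0) {s : ℝ}
    (hs : ∀ i j, G.Adj i j → s * ‖v i + v j‖ ^ 2 ≤ 2) {c : ℝ} (hc : 1 ≤ c) :
    ∃ T : Finset (Fin n), (∀ i ∈ T, ∀ j ∈ T, ¬ G.Adj i j) ∧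
      n * (tailConst * exp (-c ^ 2 / 2) / c) - Nat.card G.edgeSet * (exp (-s * c ^ 2) / c ^ 2)
        ≤ T.card := by
  have hT := G.exists_independent_card_ge_of_random (stdGaussian E)
    (fun i => (fun r => inner ℝ (v i) r) ⁻¹' Set.Ici c)
    (fun i => measurableSet_Ici.preimage (by fun_prop))
    (p := tailConst * exp (-c ^ 2 / 2) / c) (q := exp (-s * c ^ 2) / c ^ 2)
    (fun i => ?_) fun i j hij => ?_
  · simpa using hT
  · rw [← map_measureReal_apply (by fun_prop) measurableSet_Ici, stdGaussian_map_inner (hv i)]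
    exact tailConst_le_gaussianReal_Ici hc
  · exact stdGaussian_real_inner_both_ge_le (hv i) (hv j) (hinner i j hij) (hs i j hij)
      (by linarith)

/-- A choice of threshold `c` and decay rate `s` for the rounding of a vector `α`-coloring, for
all `α ≥ 2`. -/
lemma exists_threshold_and_rate {κ : ℝ} (hκ : 0 < κ) {α : ℝ} (hα : 2 ≤ α) :
    ∃ D₀ : ℝ, 1 < D₀ ∧ ∃ c₀ : ℝ, 0 < c₀ ∧ ∀ D : ℝ, D₀ ≤ D → ∃ c s : ℝ, 1 ≤ c ∧
      (∀ x : ℝ, 0 ≤ x → x ≤ 2 - 2 * (1 / (α - 1)) → s * x ≤ 2) ∧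
      c₀ / (D ^ (1 - 2 / α) * log D ^ (1 / α)) ≤
        κ * exp (-c ^ 2 / 2) / c - D / 2 * (exp (-s * c ^ 2) / c ^ 2) := by
  rcases hα.eq_or_lt with rfl | hα
  · refine ⟨exp 1, one_lt_exp_iff.2 one_pos, κ * exp (-1 / 2) / 2, by positivity, fun D hD => ?_⟩
    have hD0 : 0 < D := (exp_pos 1).trans_le hD
    have hlog : 1 ≤ log D := by rwa [le_log_iff_exp_le hD0]
    refine ⟨1, log (D / (κ * exp (-1 / 2))), le_rfl, fun x hx0 hx => ?_, ?_⟩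
    · obtain rfl : x = 0 := le_antisymm (by norm_num at hx; exact hx) hx0
      simp
    · have hexp : exp (-log (D / (κ * exp (-1 / 2)))) = κ * exp (-1 / 2) / D := by
        rw [exp_neg, exp_log (by positivity), inv_div]
      have hpow : 1 ≤ log D ^ (1 / 2 : ℝ) := one_le_rpow hlog (by norm_num)
      norm_num at hexp hpow ⊢
      rw [hexp]
      have h1 : D / 2 * (κ * exp (-1 / 2) / D) = κ * exp (-1 / 2) / 2 := by field_simp
      norm_num at h1
      rw [h1]
      refine (div_le_self (by positivity) hpow).trans (by linarith)
  · obtain ⟨D₀, hD₀, c₀, hc₀, h⟩ := exists_threshold hκ hα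
    refine ⟨D₀, hD₀, c₀, hc₀, fun D hD => ?_⟩
    obtain ⟨c, hc, hle⟩ := h D hD
    refine ⟨c, (α - 1) / (α - 2), hc, fun x _ hx => ?_, hle⟩
    have h1 : 0 < α - 1 := by linarith
    have h2 : 0 < α - 2 := by linarith
    calc (α - 1) / (α - 2) * x ≤ (α - 1) / (α - 2) * (2 - 2 * (1 / (α - 1))) := by gcongr
      _ = 2 := by field_simp; ring

theorem stmt_5 (α : ℝ) (hα : 2 ≤ α) : ∃ D₀ : ℝ, 1 < D₀ ∧ ∃ c₀ : ℝ, 0 < c₀ ∧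
    ∀ (n : ℕ), 1 ≤ n → ∀ (G : SimpleGraph (Fin n)) (v : Fin n → (Fin n → ℝ)),
      (∀ i, ∑ k, (v i k) ^ 2 = 1) →
      (∀ i j, G.Adj i j → ∑ k, v i k * v j k ≤ -(1 / (α - 1))) →
      ∀ D : ℝ, D = 2 * (Nat.card G.edgeSet : ℝ) / n →
        D₀ ≤ D →
        ∃ S : Finset (Fin n), (∀ i ∈ S, ∀ j ∈ S, ¬ G.Adj i j) ∧
          c₀ * n / (D ^ (1 - 2 / α) * (Real.log D) ^ ((1 : ℝ) / α)) ≤ S.card := by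
  obtain ⟨D₀, hD₀, c₀, hc₀, hthr⟩ := exists_threshold_and_rate tailConst_pos hα
  refine ⟨D₀, hD₀, c₀, hc₀, fun n hn G v hv hvec D hD hDD => ?_⟩
  obtain ⟨c, s, hc, hs, hle⟩ := hthr D hDD
  have hnorm : ∀ i, ‖WithLp.toLp 2 (v i)‖ = 1 := fun i => by
    simp [EuclideanSpace.norm_eq, hv i]
  have hinner : ∀ i j, G.Adj i j →
      inner ℝ (WithLp.toLp 2 (v i)) (WithLp.toLp 2 (v j)) ≤ -(1 / (α - 1)) := fun i j hij => by
    simpa [PiLp.inner_apply, mul_comm] using hvec i j hij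
  have hα1 : 0 < 1 / (α - 1) := one_div_pos.2 (by linarith)
  obtain ⟨T, hT, hcard⟩ := exists_independent_card_ge_of_unit_vectors G
    (fun i => WithLp.toLp 2 (v i)) hnorm (fun i j hij => (hinner i j hij).trans (by linarith))
    (s := s) (fun i j hij => hs _ (sq_nonneg _) (by
      rw [norm_add_sq_real, hnorm, hnorm]; linarith [hinner i j hij])) hc
  refine ⟨T, hT, le_trans ?_ hcard⟩
  have hn0 : (0 : ℝ) < n := by exact_mod_cast hn
  have hE : (Nat.card G.edgeSet : ℝ) = n * (D / 2) := by rw [hD]; field_simp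
  rw [hE, mul_comm c₀, mul_div_assoc, mul_assoc (n : ℝ), ← mul_sub]
  exact mul_le_mul_of_nonneg_left hle hn0.le
end

section
/- Let α > 2 be a real number and let G be a finite simple graph with vertex set {1,…,n} admitting a vector α-coloring v₁,…,vₙ. Then for every vertex v of G, the subgraph of G induced by the set N(v) of neighbors of v admits a vector (α−1)-coloring; that is, there exist unit vectors (w_i)_{i ∈ N(v)} in ℝ^n such that w_i·w_j ≤ −1/(α−2) whenever i, j ∈ N(v) are adjacent in G. -/
/-- The inner product of the components of `y` and `z` orthogonal to a unit vector `x`, where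
`a` and `b` are the negatives of the inner products of `y` and `z` with `x`. -/
lemma sum_add_mul_mul_add_mul {ι : Type*} [Fintype ι] (x y z : ι → ℝ) (a b : ℝ)
    (hx : ∑ k, x k ^ 2 = 1) (hy : ∑ k, y k * x k = -a) (hz : ∑ k, z k * x k = -b) :
    ∑ k, (y k + a * x k) * (z k + b * x k) = ∑ k, y k * z k - a * b := by
  have h : ∀ k, (y k + a * x k) * (z k + b * x k) =
      y k * z k + b * (y k * x k) + a * (z k * x k) + a * b * x k ^ 2 := fun k => by ring
  simp only [h, Finset.sum_add_distrib, ← Finset.mul_sum, hx, hy, hz]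
  ring

/-- The numerical inequality behind the normalisation of the projected vectors. -/
lemma div_one_sub_le_of_le {c a b s t : ℝ} (hc : 0 < c) (ha : c ≤ a) (hb : c ≤ b)
    (hs : 0 < s) (ht : 0 < t) (hsa : s ^ 2 = 1 - a ^ 2) (htb : t ^ 2 = 1 - b ^ 2) :
    c / (1 - c) ≤ (c + a * b) / (s * t) := by
  have hc1 : c < 1 := by nlinarith [sq_pos_of_pos hs]
  have hst : s * t ≤ 1 - c ^ 2 := by nlinarith [sq_nonneg (s - t)]
  have hab : c ^ 2 ≤ a * b := by nlinarith
  rw [div_le_div_iff₀ (by linarith) (by positivity)]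
  calc c * (s * t) ≤ c * (1 - c ^ 2) := by gcongr
    _ = (c + c ^ 2) * (1 - c) := by ring
    _ ≤ (c + a * b) * (1 - c) := by
      have : 0 ≤ 1 - c := by linarith
      gcongr

theorem stmt_7 (α : ℝ) (hα : 2 < α) (n : ℕ) (G : SimpleGraph (Fin n))
    (v : Fin n → (Fin n → ℝ))
    (hunit : ∀ i, ∑ k, (v i k) ^ 2 = 1)
    (hcol : ∀ i j, G.Adj i j → ∑ k, v i k * v j k ≤ -(1 / (α - 1))) :
    ∀ u : Fin n, ∃ w : Fin n → (Fin n → ℝ),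
      (∀ i, i ∈ G.neighborSet u → ∑ k, (w i k) ^ 2 = 1) ∧
      (∀ i j, i ∈ G.neighborSet u → j ∈ G.neighborSet u → G.Adj i j →
        ∑ k, w i k * w j k ≤ -(1 / (α - 2))) := by
  intro u
  set c : ℝ := 1 / (α - 1) with hc
  have hc0 : 0 < c := one_div_pos.2 (by linarith)
  have hcα : 1 / (α - 2) = c / (1 - c) := by
    have h1 : α - 1 ≠ 0 := by linarith
    have h2 : α - 2 ≠ 0 := by linarith
    have h3 : 1 - c = (α - 2) / (α - 1) := by rw [hc]; field_simp; ring
    rw [h3, hc]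
    field_simp
  obtain ⟨a, ha⟩ : ∃ a : Fin n → ℝ, ∀ i, ∑ k, v i k * v u k = -a i :=
    ⟨fun i => -∑ k, v i k * v u k, fun i => (neg_neg _).symm⟩
  have hca : ∀ i, G.Adj u i → c ≤ a i := fun i hi => by
    have := hcol i u hi.symm
    rw [ha] at this
    linarith
  have hproj : ∀ i, ∑ k, (v i k + a i * v u k) ^ 2 = 1 - a i ^ 2 := fun i => by
    have := sum_add_mul_mul_add_mul (v u) (v i) (v i) (a i) (a i) (hunit u) (ha i) (ha i)
    simpa only [← pow_two, hunit] using this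
  have hnonneg : ∀ i, 0 ≤ 1 - a i ^ 2 := fun i => by
    rw [← hproj]
    positivity
  have hpos : ∀ i j, G.Adj u i → G.Adj u j → G.Adj i j → 0 < 1 - a i ^ 2 := by
    intro i j hi hj hij
    refine lt_of_le_of_ne (hnonneg i) fun h => ?_
    have hzero := hproj i
    rw [← h, Finset.sum_eq_zero_iff_of_nonneg fun _ _ => sq_nonneg _] at hzero
    have hv : ∀ k, v i k * v j k = -a i * (v j k * v u k) := fun k => by
      have := pow_eq_zero_iff (two_ne_zero) |>.1 (hzero k (Finset.mem_univ k))
      linear_combination v j k * this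
    have hle := hcol i j hij
    simp only [hv, ← Finset.mul_sum, ha] at hle
    nlinarith [hca i hi, hca j hj, mul_pos (hc0.trans_le (hca i hi)) (hc0.trans_le (hca j hj))]
  refine ⟨fun i k => if 1 - a i ^ 2 = 0 then v i k else
    (v i k + a i * v u k) / √(1 - a i ^ 2), fun i _ => ?_, fun i j hi hj hij => ?_⟩
  · by_cases h : 1 - a i ^ 2 = 0
    · simp only [h, if_true, hunit]
    · simp only [h, if_false, div_pow, ← Finset.sum_div, hproj, Real.sq_sqrt (hnonneg i)]
      exact div_self h
  · have hpi := hpos i j hi hj hij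
    have hpj := hpos j i hj hi hij.symm
    simp only [hpi.ne', hpj.ne', if_false, div_mul_div_comm, ← Finset.sum_div]
    rw [sum_add_mul_mul_add_mul _ _ _ _ _ (hunit u) (ha i) (ha j), hcα, le_neg, ← neg_div]
    refine (div_one_sub_le_of_le hc0 (hca i hi) (hca j hj) (Real.sqrt_pos.2 hpi)
      (Real.sqrt_pos.2 hpj) (Real.sq_sqrt hpi.le) (Real.sq_sqrt hpj.le)).trans ?_
    have := hcol i j hij
    gcongr
    linarith
end

section
/- Let v₀, vᵢ, vⱼ be unit vectors in a real inner product space with |v₀·vᵢ| < 1, |v₀·vⱼ| < 1, and (v₀+vᵢ)·(v₀+vⱼ) = 0. Let v′ᵢ = (vᵢ − (v₀·vᵢ)v₀)/‖vᵢ − (v₀·vᵢ)v₀‖ and v′ⱼ = (vⱼ − (v₀·vⱼ)v₀)/‖vⱼ − (v₀·vⱼ)v₀‖ be the normalized projections of vᵢ and vⱼ onto the orthogonal complement of v₀. Then v′ᵢ·v′ⱼ = −√((1+(v₀·vᵢ))/(1−(v₀·vᵢ))) · √((1+(v₀·vⱼ))/(1−(v₀·vⱼ))). -/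
open scoped RealInnerProductSpace

section

variable {E : Type*} [NormedAddCommGroup E] [InnerProductSpace ℝ E]

/-- The inner product of the components of `x` and `y` orthogonal to a unit vector `u`. -/
lemma inner_sub_inner_smul_sub_inner_smul {u : E} (hu : ‖u‖ = 1) (x y : E) :
    ⟪x - ⟪u, x⟫ • u, y - ⟪u, y⟫ • u⟫ = ⟪x, y⟫ - ⟪u, x⟫ * ⟪u, y⟫ := by
  simp only [inner_sub_left, inner_sub_right, real_inner_smul_left, real_inner_smul_right,
    real_inner_self_eq_norm_sq, hu, real_inner_comm u x]
  ring

lemma inv_norm_sub_inner_smul_mul {u x : E} (hu : ‖u‖ = 1) (hx : ‖x‖ = 1)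
    (h : |⟪u, x⟫| < 1) :
    ‖x - ⟪u, x⟫ • u‖⁻¹ * (1 + ⟪u, x⟫) = √((1 + ⟪u, x⟫) / (1 - ⟪u, x⟫)) := by
  obtain ⟨h₁, h₂⟩ := abs_lt.mp h
  have hpos : 0 < 1 + ⟪u, x⟫ := by linarith
  have hpos' : 0 < 1 - ⟪u, x⟫ := by linarith
  have hnorm : ‖x - ⟪u, x⟫ • u‖ ^ 2 = (1 + ⟪u, x⟫) * (1 - ⟪u, x⟫) := by
    rw [← real_inner_self_eq_norm_sq, inner_sub_inner_smul_sub_inner_smul hu,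
      real_inner_self_eq_norm_sq, hx]
    ring
  symm
  rw [Real.sqrt_eq_iff_mul_self_eq (by positivity) (by positivity), ← sq, mul_pow, inv_pow, hnorm]
  field_simp

end

theorem stmt_9 {E : Type*} [NormedAddCommGroup E] [InnerProductSpace ℝ E]
    (v₀ vi vj : E) (h₀ : ‖v₀‖ = 1) (hi : ‖vi‖ = 1) (hj : ‖vj‖ = 1)
    (hi' : |⟪v₀, vi⟫| < 1) (hj' : |⟪v₀, vj⟫| < 1)
    (horth : ⟪v₀ + vi, v₀ + vj⟫ = 0) :
    ⟪(‖vi - ⟪v₀, vi⟫ • v₀‖)⁻¹ • (vi - ⟪v₀, vi⟫ • v₀),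
      (‖vj - ⟪v₀, vj⟫ • v₀‖)⁻¹ • (vj - ⟪v₀, vj⟫ • v₀)⟫
      = -(Real.sqrt ((1 + ⟪v₀, vi⟫) / (1 - ⟪v₀, vi⟫)) *
          Real.sqrt ((1 + ⟪v₀, vj⟫) / (1 - ⟪v₀, vj⟫))) := by
  have hinner : ⟪vi - ⟪v₀, vi⟫ • v₀, vj - ⟪v₀, vj⟫ • v₀⟫ =
      -((1 + ⟪v₀, vi⟫) * (1 + ⟪v₀, vj⟫)) := by
    rw [inner_sub_inner_smul_sub_inner_smul h₀]
    simp only [inner_add_left, inner_add_right, real_inner_self_eq_norm_sq, h₀,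
      real_inner_comm v₀ vi] at horth
    linarith
  rw [real_inner_smul_left, real_inner_smul_right, hinner,
    ← inv_norm_sub_inner_smul_mul h₀ hi hi', ← inv_norm_sub_inner_smul_mul h₀ hj hj']
  ring
end

section
/- The sequence (α_k)_{k≥2} is well defined and satisfies 0 ≤ α_k < 1 for every k ≥ 2, and for every k ≥ 4 it satisfies the identity ( 2α_k/(1 − 2/k) − (1 − α_k)/(1 − α_{k−2}) ) · (3/k) = 1 − α_k. -/
/-- The sequence `α₂ = 0`, `α₃ = 3/14`, and
`α_k = 1 − 6/(k + 4 + 3(1 − 2/k)/(1 − α_{k−2}))` for `k ≥ 4`. -/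
noncomputable def alph : ℕ → ℝ
  | 0 => 0
  | 1 => 0
  | 2 => 0
  | 3 => 3 / 14
  | (n + 4) =>
      1 - 6 / (((n : ℝ) + 4) + 4 + 3 * (1 - 2 / ((n : ℝ) + 4)) / (1 - alph (n + 2)))

/-- The denominator in the recursion for `alph` is at least `6`. -/
theorem six_le_alph_denom {x y : ℝ} (hx : 4 ≤ x) (hy : 0 < y) :
    6 ≤ x + 4 + 3 * (1 - 2 / x) / y := by
  have hc : 0 ≤ 1 - 2 / x := by
    rw [sub_nonneg, div_le_one (by linarith)]
    linarith
  have : 0 ≤ 3 * (1 - 2 / x) / y := by positivity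
  linarith

theorem alph_mem_Ico (n : ℕ) : 0 ≤ alph n ∧ alph n < 1 := by
  induction n using alph.induct with
  | case1 | case2 | case3 | case4 => norm_num [alph]
  | case5 n ih =>
    have hD := six_le_alph_denom (x := (n : ℝ) + 4) (by linarith [n.cast_nonneg (α := ℝ)])
      (sub_pos.2 ih.2)
    rw [alph]
    exact ⟨sub_nonneg.2 (div_le_one_of_le₀ hD (by linarith)),
      sub_lt_self _ (div_pos (by norm_num) (by linarith))⟩

/-- The recursion in the form of the identity, with `a` in place of `alph k`, `y` in place of
`1 - alph (k - 2)` and `x` in place of `k`. -/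
theorem identity_of_recursion {a x y : ℝ} (hx : 4 ≤ x) (hy : 0 < y)
    (ha : a = 1 - 6 / (x + 4 + 3 * (1 - 2 / x) / y)) :
    (2 * a / (1 - 2 / x) - (1 - a) / y) * (3 / x) = 1 - a := by
  have hD := six_le_alph_denom hx hy
  have hx0 : x ≠ 0 := by linarith
  have hx2 : x - 2 ≠ 0 := by linarith
  have key : (1 - a) * (x + 4 + 3 * (1 - 2 / x) / y) = 6 := by
    rw [ha, sub_sub_cancel]
    exact div_mul_cancel₀ _ (by linarith)
  have hc : 1 - 2 / x = (x - 2) / x := by field_simp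
  rw [hc] at key ⊢
  field_simp at key ⊢
  linear_combination -key

theorem stmt_12 :
    (∀ k : ℕ, 2 ≤ k → 0 ≤ alph k ∧ alph k < 1) ∧
    (∀ k : ℕ, 4 ≤ k →
      (2 * alph k / (1 - 2 / (k : ℝ)) - (1 - alph k) / (1 - alph (k - 2))) * (3 / (k : ℝ))
        = 1 - alph k) := by
  refine ⟨fun k _ => alph_mem_Ico k, fun k hk => ?_⟩
  obtain ⟨n, rfl⟩ := Nat.exists_eq_add_of_le' hk
  refine identity_of_recursion (by exact_mod_cast hk) (sub_pos.2 (alph_mem_Ico _).2) ?_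
  rw [alph]
  push_cast
  rfl
end

section
/- Let n ≥ 1, let x₁,…,xₙ and y₁,…,yₙ be nonnegative real numbers, and let α ≥ 0, β ≥ 0, and 0 < δ < 1 be reals such that Σ_{i=1}^n xᵢ = α·n and Σ_{i=1}^n xᵢ ≥ β·Σ_{i=1}^n yᵢ. Then there exists an index i with 1 ≤ i ≤ n such that xᵢ ≥ δ·α and xᵢ ≥ (1−δ)·β·yᵢ. -/
theorem stmt_15 (n : ℕ) (hn : 1 ≤ n) (x y : Fin n → ℝ)
    (hx : ∀ i, 0 ≤ x i) (hy : ∀ i, 0 ≤ y i)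
    (α β δ : ℝ) (hα : 0 ≤ α) (hβ : 0 ≤ β) (hδ0 : 0 < δ) (hδ1 : δ < 1)
    (hsum : ∑ i, x i = α * n) (hxy : β * ∑ i, y i ≤ ∑ i, x i) :
    ∃ i : Fin n, δ * α ≤ x i ∧ (1 - δ) * β * y i ≤ x i := by
  by_contra! h
  have hδ : 0 ≤ 1 - δ := by linarith
  have hlt : ∀ i, x i < δ * α + (1 - δ) * β * y i := fun i => by
    have hleft : 0 ≤ δ * α := by positivity
    have hright : 0 ≤ (1 - δ) * β * y i := mul_nonneg (mul_nonneg hδ hβ) (hy i)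
    rcases le_or_gt (δ * α) (x i) with hi | hi
    · linarith [h i hi]
    · linarith
  have hsum_lt : ∑ i, x i < ∑ i, (δ * α + (1 - δ) * β * y i) :=
    Finset.sum_lt_sum_of_nonempty ⟨⟨0, hn⟩, Finset.mem_univ _⟩ fun i _ => hlt i
  rw [Finset.sum_add_distrib, Finset.sum_const, ← Finset.mul_sum, Finset.card_univ,
    Fintype.card_fin, nsmul_eq_mul] at hsum_lt
  have hδsum : δ * ∑ i, x i = δ * (α * n) := by rw [hsum]
  linarith [mul_le_mul_of_nonneg_left hxy hδ]
end

section
/- Let G = (V,E) be a finite simple graph, let R ⊆ V, and let U ⊆ V ∖ R be nonempty. Suppose there are reals d > 0, 0 < δ < 1, and λ > 0 such that d ≤ d(v) < d(1+δ) for every v ∈ U, and D_R(U) ≥ λ·D(U). Then there exists a vertex v ∈ R such that D_R(N(v) ∩ U) ≥ (1−δ)·λ·D(N(v) ∩ U). -/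
open scoped Classical

/-- Double counting: summing `f` over the neighbours in `U` of each vertex of `R` counts every
`u ∈ U` once for each of its neighbours in `R`. -/
theorem sum_filter_adj_eq_sum_card_mul {V : Type*} [Fintype V] (G : SimpleGraph V)
    (R U : Finset V) (f : V → ℝ) :
    ∑ v ∈ R, ∑ u ∈ U.filter (fun u => G.Adj v u), f u =
      ∑ u ∈ U, (Nat.card ↥(G.neighborSet u ∩ ↑R) : ℝ) * f u := by
  simp_rw [Finset.sum_filter]
  rw [Finset.sum_comm]
  refine Finset.sum_congr rfl fun u _ => ?_
  have hset : G.neighborSet u ∩ ↑R = ↑(R.filter fun v => G.Adj v u) := by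
    ext v
    simp [G.adj_comm, and_comm]
  rw [← Finset.sum_filter, Finset.sum_const, nsmul_eq_mul, hset, Nat.card_coe_set_eq,
    Set.ncard_coe_finset]

/-- If the average of `r` over `U` is at least `c ≥ 0`, then `∑ r² ≥ c ∑ r`. -/
theorem mul_sum_le_sum_sq {V : Type*} (U : Finset V) (r : V → ℝ) {c : ℝ} (hc : 0 ≤ c)
    (h : U.card * c ≤ ∑ u ∈ U, r u) :
    c * ∑ u ∈ U, r u ≤ ∑ u ∈ U, r u * r u := by
  have hsq : ∑ u ∈ U, (2 * c * r u - c * c) ≤ ∑ u ∈ U, r u * r u :=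
    Finset.sum_le_sum fun u _ => by nlinarith [sq_nonneg (r u - c)]
  rw [Finset.sum_sub_distrib, ← Finset.mul_sum, Finset.sum_const, nsmul_eq_mul] at hsq
  nlinarith [mul_le_mul_of_nonneg_left h hc]

theorem stmt_16 {V : Type*} [Fintype V] (G : SimpleGraph V)
    (R U : Finset V) (hU : U.Nonempty) (hUR : ∀ v ∈ U, v ∉ R)
    (d δ lam : ℝ) (hd : 0 < d) (hδ0 : 0 < δ) (hδ1 : δ < 1) (hlam : 0 < lam)
    (hdeg : ∀ v ∈ U, d ≤ (Nat.card (G.neighborSet v) : ℝ) ∧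
      (Nat.card (G.neighborSet v) : ℝ) < d * (1 + δ))
    (hDR : lam * (∑ v ∈ U, (Nat.card (G.neighborSet v) : ℝ)) ≤
      ∑ v ∈ U, (Nat.card ↥(G.neighborSet v ∩ ↑R) : ℝ)) :
    ∃ v ∈ R,
      (1 - δ) * lam *
          (∑ u ∈ U.filter fun u => G.Adj v u, (Nat.card (G.neighborSet u) : ℝ)) ≤
        ∑ u ∈ U.filter fun u => G.Adj v u, (Nat.card ↥(G.neighborSet u ∩ ↑R) : ℝ) := by
  have hsum : U.card * d ≤ ∑ v ∈ U, (Nat.card (G.neighborSet v) : ℝ) := by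
    rw [← nsmul_eq_mul]
    exact Finset.card_nsmul_le_sum _ _ _ fun v hv => (hdeg v hv).1
  have hcard : (0 : ℝ) < U.card := by exact_mod_cast hU.card_pos
  have hR : R.Nonempty := by
    rw [Finset.nonempty_iff_ne_empty]
    rintro rfl
    have hpos := mul_pos hlam ((mul_pos hcard hd).trans_le hsum)
    refine (hpos.trans_le hDR).ne' ?_
    simp
  have havg : U.card * (lam * d) ≤ ∑ u ∈ U, (Nat.card ↥(G.neighborSet u ∩ ↑R) : ℝ) :=
    le_trans (by nlinarith) hDR
  have hsq := mul_sum_le_sum_sq U _ (mul_pos hlam hd).le havg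
  refine Finset.exists_le_of_sum_le hR ?_
  rw [← Finset.mul_sum, sum_filter_adj_eq_sum_card_mul, sum_filter_adj_eq_sum_card_mul]
  refine le_trans ?_ hsq
  rw [Finset.mul_sum, Finset.mul_sum]
  refine Finset.sum_le_sum fun u hu => ?_
  have hfac : (1 - δ) * (Nat.card (G.neighborSet u) : ℝ) ≤ d := by
    nlinarith [mul_le_mul_of_nonneg_left (hdeg u hu).2.le (sub_nonneg.2 hδ1.le),
      mul_nonneg hd.le (sq_nonneg δ)]
  have hr : (0 : ℝ) ≤ lam * (Nat.card ↥(G.neighborSet u ∩ ↑R) : ℝ) :=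
    mul_nonneg hlam.le (Nat.cast_nonneg _)
  linarith [mul_le_mul_of_nonneg_left hfac hr]
end

section
/- Let n ≥ 2, let c > 0, let β ∈ (0, π/2), and let v₁, v₂ be unit vectors in ℝ^n with inner product v₁·v₂ = −cos(2β). If r is a standard Gaussian random vector in ℝ^n, then Pr[v₁·r ≥ c and v₂·r ≥ c] = (1/π)·∫₀^β exp(−c²/(2·sin²t)) dt. -/
open MeasureTheory ProbabilityTheory

theorem map_pi_gaussianReal_of_orthonormal {ι : Type*} [Fintype ι] (a b : ι → ℝ)
    (ha : ∑ i, a i ^ 2 = 1) (hb : ∑ i, b i ^ 2 = 1) (hab : ∑ i, a i * b i = 0) :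
    (Measure.pi fun _ : ι => gaussianReal 0 1).map
        (fun r => (∑ i, a i * r i, ∑ i, b i * r i))
      = (gaussianReal 0 1).prod (gaussianReal 0 1) := by
  classical
  have hmeas : Measurable fun r : ι → ℝ => (∑ i, a i * r i, ∑ i, b i * r i) := by fun_prop
  have : IsFiniteMeasure ((Measure.pi fun _ : ι => gaussianReal 0 1).map
        (fun r => (∑ i, a i * r i, ∑ i, b i * r i))) := Measure.isFiniteMeasure_map _ _
  have hlin (L : StrongDual ℝ ℝ) (t : ℝ) : L t = L 1 * t := by
    simpa [mul_comm] using L.map_smul t 1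
  have hg (t : ℝ) : ∫ x, Complex.exp ((t * x : ℝ) * Complex.I) ∂gaussianReal 0 1
      = Complex.exp (-(t ^ 2 : ℝ) / 2) := by
    have := charFun_gaussianReal (μ := 0) (v := 1) t
    rw [charFun_apply_real] at this
    simpa [neg_div] using this
  refine Measure.ext_of_charFunDual (funext fun L => ?_)
  set s := L.comp (.inl ℝ ℝ ℝ) 1 with hs
  set t := L.comp (.inr ℝ ℝ ℝ) 1 with ht
  have hL (x y : ℝ) : L (x, y) = s * x + t * y := by
    rw [← hlin, ← hlin, ContinuousLinearMap.comp_apply, ContinuousLinearMap.comp_apply, ← map_add]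
    simp
  have hr (L : StrongDual ℝ ℝ) :
      charFunDual (gaussianReal 0 1) L = Complex.exp (-((L 1) ^ 2 : ℝ) / 2) := by
    rw [charFunDual_apply, ← hg]
    exact integral_congr_ae (ae_of_all _ fun x => by dsimp only; rw [hlin L x])
  rw [charFunDual_prod, hr, hr, ← hs, ← ht, charFunDual_apply, integral_map hmeas.aemeasurable
    (by fun_prop)]
  have hsum (r : ι → ℝ) : s * (∑ i, a i * r i) + t * (∑ i, b i * r i)
      = ∑ i, (s * a i + t * b i) * r i := by
    simp only [Finset.mul_sum, ← Finset.sum_add_distrib]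
    exact Finset.sum_congr rfl fun i _ => by ring
  simp_rw [hL, hsum, Complex.ofReal_sum, Finset.sum_mul, Complex.exp_sum]
  rw [integral_fintype_prod_eq_prod
    (f := fun i x => Complex.exp (((s * a i + t * b i) * x : ℝ) * Complex.I))]
  simp_rw [hg, ← Complex.exp_sum, ← Complex.exp_add]
  have hsq : ∑ i, (s * a i + t * b i) ^ 2 = s ^ 2 + t ^ 2 := by
    calc ∑ i, (s * a i + t * b i) ^ 2
        = s ^ 2 * ∑ i, a i ^ 2 + t ^ 2 * ∑ i, b i ^ 2 + 2 * s * t * ∑ i, a i * b i := by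
          simp only [Finset.mul_sum, ← Finset.sum_add_distrib]
          exact Finset.sum_congr rfl fun i _ => by ring
      _ = _ := by rw [ha, hb, hab]; ring
  congr 1
  rw [← Finset.sum_div, Finset.sum_neg_distrib, ← Complex.ofReal_sum, hsq]
  push_cast
  ring

theorem lintegral_Ici_mul_exp_neg_sq_div_two {R : ℝ} (hR : 0 < R) :
    ∫⁻ r in Set.Ici R, ENNReal.ofReal (r * Real.exp (-r ^ 2 / 2))
      = ENNReal.ofReal (Real.exp (-R ^ 2 / 2)) := by
  have hd (x : ℝ) :
      HasDerivAt (fun r : ℝ => -Real.exp (-r ^ 2 / 2)) (x * Real.exp (-x ^ 2 / 2)) x := by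
    have h := (((hasDerivAt_pow 2 x).fun_neg.div_const 2).exp).fun_neg
    exact h.congr_deriv (by simp; ring)
  have hpos : ∀ x ∈ Set.Ioi R, 0 ≤ x * Real.exp (-x ^ 2 / 2) := fun x hx =>
    mul_nonneg (hR.trans hx).le (Real.exp_pos _).le
  have hlim : Filter.Tendsto (fun r : ℝ => -Real.exp (-r ^ 2 / 2)) Filter.atTop (nhds 0) := by
    rw [← neg_zero]
    refine (Real.tendsto_exp_atBot.comp ?_).neg
    simp_rw [neg_div]
    exact Filter.tendsto_neg_atTop_atBot.comp
      ((Filter.tendsto_pow_atTop two_ne_zero).atTop_div_const two_pos)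
  have hint := integrableOn_Ioi_deriv_of_nonneg' (fun x _ => hd x) hpos hlim
  rw [setLIntegral_congr Ioi_ae_eq_Ici.symm, ← ofReal_integral_eq_lintegral_ofReal hint
    ((ae_restrict_iff' measurableSet_Ioi).2 (ae_of_all _ hpos)),
    integral_Ioi_of_hasDerivAt_of_nonneg' (fun x _ => hd x) hpos hlim]
  simp

theorem wedge_polar_iff {c β r φ : ℝ} (hc : 0 < c) (hβ : β ∈ Set.Ioo 0 (Real.pi / 2))
    (hr : 0 < r) (hφ : φ ∈ Set.Ioo (-Real.pi) Real.pi) :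
    (c ≤ Real.sin β * (r * Real.cos φ) + Real.cos β * (r * Real.sin φ) ∧
        c ≤ Real.sin β * (r * Real.cos φ) - Real.cos β * (r * Real.sin φ))
      ↔ |φ| < β ∧ c / Real.sin (β - |φ|) ≤ r := by
  have h1 : Real.sin β * (r * Real.cos φ) + Real.cos β * (r * Real.sin φ)
      = r * Real.sin (β + φ) := by rw [Real.sin_add]; ring
  have h2 : Real.sin β * (r * Real.cos φ) - Real.cos β * (r * Real.sin φ)
      = r * Real.sin (β - φ) := by rw [Real.sin_sub]; ring
  have habs : (c ≤ r * Real.sin (β + φ) ∧ c ≤ r * Real.sin (β - φ))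
      ↔ (c ≤ r * Real.sin (β + |φ|) ∧ c ≤ r * Real.sin (β - |φ|)) := by
    rcases abs_choice φ with h | h <;> rw [h]
    rw [sub_neg_eq_add, ← sub_eq_add_neg, and_comm]
  have hlt : |φ| < Real.pi := abs_lt.2 hφ
  have h0 : 0 ≤ |φ| := abs_nonneg φ
  rw [h1, h2, habs]
  obtain ⟨hβ0, hβ1⟩ := hβ
  constructor
  · rintro ⟨-, h⟩
    have hs : 0 < Real.sin (β - |φ|) := (mul_pos_iff_of_pos_left hr).1 (hc.trans_le h)
    refine ⟨?_, (div_le_iff₀ hs).2 h⟩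
    by_contra! hge
    exact hs.not_ge (Real.sin_nonpos_of_nonpos_of_neg_pi_le (by linarith) (by linarith))
  · rintro ⟨hlt, h⟩
    have hs : 0 < Real.sin (β - |φ|) := Real.sin_pos_of_pos_of_lt_pi (by linarith) (by linarith)
    have h' := (div_le_iff₀ hs).1 h
    refine ⟨h'.trans (mul_le_mul_of_nonneg_left ?_ hr.le), h'⟩
    have := mul_nonneg (Real.cos_nonneg_of_neg_pi_div_two_le_of_le (by linarith) hβ1.le)
      (Real.sin_nonneg_of_nonneg_of_le_pi h0 (by linarith))
    rw [Real.sin_sub, Real.sin_add]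
    linarith

theorem gaussianReal_prod_eq_withDensity :
    (gaussianReal 0 1).prod (gaussianReal 0 1) = (volume : Measure (ℝ × ℝ)).withDensity
      fun p => ENNReal.ofReal ((2 * Real.pi)⁻¹ * Real.exp (-(p.1 ^ 2 + p.2 ^ 2) / 2)) := by
  rw [gaussianReal_of_var_ne_zero 0 one_ne_zero,
    prod_withDensity (measurable_gaussianPDF 0 1) (measurable_gaussianPDF 0 1)]
  refine congrArg _ (funext fun p => ?_)
  rw [gaussianPDF, gaussianPDF, ← ENNReal.ofReal_mul (gaussianPDFReal_nonneg _ _ _),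
    gaussianPDFReal, gaussianPDFReal, mul_mul_mul_comm, ← Real.exp_add, ← mul_inv]
  have : (0 : ℝ) ≤ 2 * Real.pi := by positivity
  simp only [NNReal.coe_one, mul_one, sub_zero, Real.mul_self_sqrt this]
  ring_nf

theorem measurableSet_wedge (c β : ℝ) : MeasurableSet {p : ℝ × ℝ |
    c ≤ Real.sin β * p.1 + Real.cos β * p.2 ∧ c ≤ Real.sin β * p.1 - Real.cos β * p.2} := by
  rw [Set.ofPred_and]
  exact (measurableSet_le (by fun_prop) (by fun_prop)).inter
    (measurableSet_le (by fun_prop) (by fun_prop))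

theorem gaussianReal_prod_wedge {c β : ℝ} (hc : 0 < c) (hβ : β ∈ Set.Ioo 0 (Real.pi / 2)) :
    ((gaussianReal 0 1).prod (gaussianReal 0 1))
        {p | c ≤ Real.sin β * p.1 + Real.cos β * p.2 ∧ c ≤ Real.sin β * p.1 - Real.cos β * p.2}
      = ∫⁻ φ in Set.Ioo (-β) β, ENNReal.ofReal
          ((2 * Real.pi)⁻¹ * Real.exp (-(c ^ 2) / (2 * Real.sin (β - |φ|) ^ 2))) := by
  set S : Set (ℝ × ℝ) :=
    {p | c ≤ Real.sin β * p.1 + Real.cos β * p.2 ∧ c ≤ Real.sin β * p.1 - Real.cos β * p.2} with hS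
  have hSm : MeasurableSet S := measurableSet_wedge c β
  set f : ℝ × ℝ → ENNReal := S.indicator fun p =>
    ENNReal.ofReal ((2 * Real.pi)⁻¹ * Real.exp (-(p.1 ^ 2 + p.2 ^ 2) / 2)) with hf
  have hfm : Measurable f := Measurable.indicator (by fun_prop) hSm
  have hpi : (0 : ℝ) ≤ (2 * Real.pi)⁻¹ := by positivity
  rw [gaussianReal_prod_eq_withDensity, withDensity_apply _ hSm, ← lintegral_indicator hSm, ← hf,
    ← lintegral_comp_polarCoord_symm, polarCoord_target, Measure.volume_eq_prod,
    setLIntegral_prod_symm _ (by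
      have := hfm.comp continuous_polarCoord_symm.measurable
      exact (Measurable.mul (by fun_prop) this).aemeasurable)]
  have hinner : ∀ φ ∈ Set.Ioo (-Real.pi) Real.pi,
      ∫⁻ r in Set.Ioi 0, ENNReal.ofReal r • f (polarCoord.symm (r, φ))
        = (Set.Ioo (-β) β).indicator (fun φ => ENNReal.ofReal
          ((2 * Real.pi)⁻¹ * Real.exp (-(c ^ 2) / (2 * Real.sin (β - |φ|) ^ 2)))) φ := by
    intro φ hφ
    by_cases hlt : |φ| < β
    · have hs : 0 < Real.sin (β - |φ|) := Real.sin_pos_of_pos_of_lt_pi (by linarith)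
        (by linarith [hβ.2, abs_nonneg φ, Real.pi_pos])
      have hR : 0 < c / Real.sin (β - |φ|) := div_pos hc hs
      have hpt : ∀ r ∈ Set.Ioi (0 : ℝ), ENNReal.ofReal r • f (polarCoord.symm (r, φ))
          = (Set.Ici (c / Real.sin (β - |φ|))).indicator (fun r =>
            ENNReal.ofReal (2 * Real.pi)⁻¹ * ENNReal.ofReal (r * Real.exp (-r ^ 2 / 2))) r := by
        intro r hr
        have hiff := wedge_polar_iff hc hβ hr hφ
        simp only [hlt, true_and] at hiff
        have hsq : (r * Real.cos φ) ^ 2 + (r * Real.sin φ) ^ 2 = r ^ 2 := by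
          linear_combination r ^ 2 * Real.sin_sq_add_cos_sq φ
        simp only [hf, Set.indicator_apply, hS, Set.mem_ofPred_eq, polarCoord_symm_apply, hiff,
          Set.mem_Ici, hsq, smul_eq_mul, mul_ite, mul_zero]
        refine if_congr Iff.rfl ?_ rfl
        rw [← ENNReal.ofReal_mul (le_of_lt hr), ← ENNReal.ofReal_mul hpi]
        ring_nf
      rw [setLIntegral_congr_fun measurableSet_Ioi hpt, setLIntegral_indicator measurableSet_Ici,
        Set.inter_eq_left.2 (Set.Ici_subset_Ioi.2 hR), lintegral_const_mul _ (by fun_prop),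
        lintegral_Ici_mul_exp_neg_sq_div_two hR, ← ENNReal.ofReal_mul hpi,
        Set.indicator_of_mem (Set.mem_Ioo.2 (abs_lt.1 hlt))]
      congr 3
      field_simp
    · rw [Set.indicator_of_notMem (fun h => hlt (abs_lt.2 (Set.mem_Ioo.1 h))), setLIntegral_congr_fun
        (g := fun _ => 0) measurableSet_Ioi, lintegral_zero]
      intro r hr
      have hn : polarCoord.symm (r, φ) ∉ S := fun h =>
        hlt ((wedge_polar_iff hc hβ hr hφ).1 h).1
      simp only [hf, Set.indicator_of_notMem hn, smul_zero]
  rw [setLIntegral_congr_fun measurableSet_Ioo hinner, setLIntegral_indicator measurableSet_Ioo,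
    Set.inter_eq_left.2 (Set.Ioo_subset_Ioo (by linarith [hβ.2, Real.pi_pos])
      (by linarith [hβ.2, Real.pi_pos]))]

theorem toReal_lintegral_wedge {c β : ℝ} (hβ : 0 ≤ β) :
    (∫⁻ φ in Set.Ioo (-β) β, ENNReal.ofReal
        ((2 * Real.pi)⁻¹ * Real.exp (-(c ^ 2) / (2 * Real.sin (β - |φ|) ^ 2)))).toReal
      = 1 / Real.pi * ∫ t in (0 : ℝ)..β, Real.exp (-(c ^ 2) / (2 * Real.sin t ^ 2)) := by
  set g : ℝ → ℝ := fun t => Real.exp (-(c ^ 2) / (2 * Real.sin t ^ 2)) with hg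
  have hgm : Measurable g := by fun_prop
  have hle (t : ℝ) : ‖g t‖ ≤ 1 := by
    rw [Real.norm_of_nonneg (Real.exp_pos _).le, Real.exp_le_one_iff]
    exact div_nonpos_of_nonpos_of_nonneg (by nlinarith [sq_nonneg c]) (by positivity)
  have hint (a b : ℝ) : IntervalIntegrable (fun φ => g (β - |φ|)) volume a b :=
    (intervalIntegrable_const (c := (1 : ℝ))).mono_fun
      (hgm.comp (by fun_prop)).aestronglyMeasurable (ae_of_all _ fun t => by simpa using hle _)
  have hright : ∫ φ in (0 : ℝ)..β, g (β - |φ|) = ∫ t in (0 : ℝ)..β, g t := by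
    rw [intervalIntegral.integral_congr (g := fun φ => g (β - φ)),
      intervalIntegral.integral_comp_sub_left]
    · simp
    · intro φ hφ
      rw [Set.uIcc_of_le hβ] at hφ
      simp [abs_of_nonneg hφ.1]
  have hleft : ∫ φ in (-β)..0, g (β - |φ|) = ∫ t in (0 : ℝ)..β, g t := by
    rw [← hright]
    simpa using (intervalIntegral.integral_comp_neg (a := 0) (b := β) fun φ => g (β - |φ|)).symm
  rw [← integral_eq_lintegral_of_nonneg_ae (ae_of_all _ fun φ => by positivity)
    (Measurable.aestronglyMeasurable (by fun_prop)), integral_const_mul, ← integral_Ioc_eq_integral_Ioo,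
    ← intervalIntegral.integral_of_le (by linarith)]
  change _ * ∫ φ in (-β)..β, g (β - |φ|) = _
  rw [← intervalIntegral.integral_add_adjacent_intervals (hint _ 0) (hint _ _), hleft, hright]
  field_simp
  ring

theorem stmt_17 (n : ℕ) (hn : 2 ≤ n) (c : ℝ) (hc : 0 < c) (β : ℝ)
    (hβ : β ∈ Set.Ioo 0 (Real.pi / 2))
    (v₁ v₂ : Fin n → ℝ)
    (hv₁ : ∑ i, (v₁ i) ^ 2 = 1) (hv₂ : ∑ i, (v₂ i) ^ 2 = 1)
    (hv : ∑ i, v₁ i * v₂ i = -Real.cos (2 * β)) :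
    ((Measure.pi fun _ : Fin n => gaussianReal 0 1)
        {r | c ≤ ∑ i, v₁ i * r i ∧ c ≤ ∑ i, v₂ i * r i}).toReal
      = (1 / Real.pi) * ∫ t in (0:ℝ)..β, Real.exp (-(c ^ 2) / (2 * Real.sin t ^ 2)) := by
  have hsin : 0 < Real.sin β :=
    Real.sin_pos_of_pos_of_lt_pi hβ.1 (by linarith [hβ.2, Real.pi_pos])
  have hcos : 0 < Real.cos β :=
    Real.cos_pos_of_mem_Ioo ⟨by linarith [hβ.1, Real.pi_pos], hβ.2⟩
  have hsc := Real.sin_sq_add_cos_sq β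
  rw [Real.cos_two_mul] at hv
  set a : Fin n → ℝ := fun i => (2 * Real.sin β)⁻¹ * (v₁ i + v₂ i) with ha_def
  set b : Fin n → ℝ := fun i => (2 * Real.cos β)⁻¹ * (v₁ i - v₂ i) with hb_def
  have hadd : ∑ i, (v₁ i + v₂ i) ^ 2 = (2 * Real.sin β) ^ 2 := by
    have : ∑ i, (v₁ i + v₂ i) ^ 2
        = ∑ i, v₁ i ^ 2 + ∑ i, v₂ i ^ 2 + 2 * ∑ i, v₁ i * v₂ i := by
      simp only [Finset.mul_sum, ← Finset.sum_add_distrib]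
      exact Finset.sum_congr rfl fun i _ => by ring
    rw [this, hv₁, hv₂, hv]
    linear_combination -4 * hsc
  have hsub : ∑ i, (v₁ i - v₂ i) ^ 2 = (2 * Real.cos β) ^ 2 := by
    have : ∑ i, (v₁ i - v₂ i) ^ 2
        = ∑ i, v₁ i ^ 2 + ∑ i, v₂ i ^ 2 - 2 * ∑ i, v₁ i * v₂ i := by
      simp only [Finset.mul_sum, ← Finset.sum_add_distrib, ← Finset.sum_sub_distrib]
      exact Finset.sum_congr rfl fun i _ => by ring
    rw [this, hv₁, hv₂, hv]
    ring
  have ha : ∑ i, a i ^ 2 = 1 := by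
    simp_rw [ha_def, mul_pow, ← Finset.mul_sum, hadd]
    field_simp
  have hb : ∑ i, b i ^ 2 = 1 := by
    simp_rw [hb_def, mul_pow, ← Finset.mul_sum, hsub]
    field_simp
  have hab : ∑ i, a i * b i = 0 := by
    have : ∑ i, a i * b i = (2 * Real.sin β)⁻¹ * (2 * Real.cos β)⁻¹
        * (∑ i, v₁ i ^ 2 - ∑ i, v₂ i ^ 2) := by
      simp only [← Finset.sum_sub_distrib, Finset.mul_sum]
      exact Finset.sum_congr rfl fun i _ => by ring
    rw [this, hv₁, hv₂, sub_self, mul_zero]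
  have h₁ (r : Fin n → ℝ) : ∑ i, v₁ i * r i
      = Real.sin β * ∑ i, a i * r i + Real.cos β * ∑ i, b i * r i := by
    simp only [Finset.mul_sum, ← Finset.sum_add_distrib]
    refine Finset.sum_congr rfl fun i _ => ?_
    simp only [ha_def, hb_def]
    field_simp
    ring
  have h₂ (r : Fin n → ℝ) : ∑ i, v₂ i * r i
      = Real.sin β * ∑ i, a i * r i - Real.cos β * ∑ i, b i * r i := by
    simp only [Finset.mul_sum, ← Finset.sum_sub_distrib]
    refine Finset.sum_congr rfl fun i _ => ?_
    simp only [ha_def, hb_def]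
    field_simp
    ring
  rw [← toReal_lintegral_wedge hβ.1.le, ← gaussianReal_prod_wedge hc hβ,
    ← map_pi_gaussianReal_of_orthonormal a b ha hb hab, Measure.map_apply (by fun_prop)
      (measurableSet_wedge c β)]
  simp only [h₁, h₂, Set.preimage_ofPred_eq]
end

section
/- Let n ≥ 2, let c > 0, let β ∈ (0, π/2), and let v₁, v₂ be unit vectors in ℝ^n with inner product v₁·v₂ = −cos(2β). If r is a standard Gaussian random vector in ℝ^n, then Pr[v₁·r ≥ c and v₂·r ≥ c] ≥ ( sin³β/(π·cos β) ) / ( c² + 2·sin²β + tan²β ) · exp( −c²/(2·sin²β) ). -/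
open MeasureTheory ProbabilityTheory

/-- The coordinates of a standard Gaussian vector along an orthonormal pair are independent
standard Gaussian variables. -/
theorem map_pi_gaussianReal_orthonormal_pair {ι : Type*} [Fintype ι] (e₁ e₂ : ι → ℝ)
    (h₁ : ∑ i, e₁ i ^ 2 = 1) (h₂ : ∑ i, e₂ i ^ 2 = 1) (h₁₂ : ∑ i, e₁ i * e₂ i = 0) :
    (Measure.pi fun _ : ι => gaussianReal 0 1).map
        (fun r => (∑ i, e₁ i * r i, ∑ i, e₂ i * r i)) =
      (gaussianReal 0 1).prod (gaussianReal 0 1) := by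
  have key : ∀ p q : ℝ, ∑ i, (p * e₁ i + q * e₂ i) ^ 2 = p ^ 2 + q ^ 2 := by
    intro p q
    have : ∀ i, (p * e₁ i + q * e₂ i) ^ 2
        = p ^ 2 * e₁ i ^ 2 + 2 * p * q * (e₁ i * e₂ i) + q ^ 2 * e₂ i ^ 2 := fun i => by ring
    simp_rw [this, Finset.sum_add_distrib, ← Finset.mul_sum, h₁, h₂, h₁₂]
    ring
  have hf : Measurable fun r : ι → ℝ => (∑ i, e₁ i * r i, ∑ i, e₂ i * r i) := by fun_prop
  have := Measure.isProbabilityMeasure_map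
    (μ := Measure.pi fun _ : ι => gaussianReal 0 1) hf.aemeasurable
  apply Measure.ext_of_charFunDual
  ext L
  set p := L (1, 0)
  set q := L (0, 1)
  have hL : ∀ x y : ℝ, L (x, y) = p * x + q * y := by
    intro x y
    have : (x, y) = x • ((1 : ℝ), (0 : ℝ)) + y • ((0 : ℝ), (1 : ℝ)) := by simp
    rw [this, map_add, map_smul, map_smul, smul_eq_mul, smul_eq_mul]
    ring
  have hint : ∀ t : ℝ, ∫ x, Complex.exp (((t * x : ℝ) : ℂ) * Complex.I) ∂gaussianReal 0 1
      = Complex.exp (-(t : ℂ) ^ 2 / 2) := by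
    intro t
    have := charFun_gaussianReal (μ := 0) (v := 1) t
    rw [charFun_apply_real] at this
    simp only [Complex.ofReal_mul]
    rw [this]
    congr 1
    push_cast
    ring
  rw [charFunDual_apply, charFunDual_apply, integral_map hf.aemeasurable (by fun_prop)]
  have e : ∀ r : ι → ℝ, Complex.exp ((L (∑ i, e₁ i * r i, ∑ i, e₂ i * r i) : ℂ) * Complex.I)
      = ∏ i, Complex.exp ((((p * e₁ i + q * e₂ i) * r i : ℝ) : ℂ) * Complex.I) := by
    intro r
    rw [← Complex.exp_sum, hL, ← Finset.sum_mul, Finset.mul_sum, Finset.mul_sum,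
      ← Finset.sum_add_distrib, ← Complex.ofReal_sum]
    congr 4
    ext i
    ring
  have e' : ∀ z : ℝ × ℝ, Complex.exp ((L z : ℂ) * Complex.I)
      = Complex.exp (((p * z.1 : ℝ) : ℂ) * Complex.I) *
        Complex.exp (((q * z.2 : ℝ) : ℂ) * Complex.I) := by
    rintro ⟨x, y⟩
    rw [← Complex.exp_add, hL]
    push_cast
    ring_nf
  simp_rw [e, e']
  rw [integral_fintype_prod_eq_prod
      (f := fun i x => Complex.exp ((((p * e₁ i + q * e₂ i) * x : ℝ) : ℂ) * Complex.I)),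
    integral_prod_mul (fun x : ℝ => Complex.exp (((p * x : ℝ) : ℂ) * Complex.I))
      (fun x : ℝ => Complex.exp (((q * x : ℝ) : ℂ) * Complex.I))]
  simp_rw [hint]
  rw [← Complex.exp_sum, ← Complex.exp_add, ← Finset.sum_div, Finset.sum_neg_distrib]
  congr 1
  have := key p q
  apply_fun ((↑) : ℝ → ℂ) at this
  push_cast at this ⊢
  rw [this]
  ring

/-- A Mills-ratio type bound, obtained from the antiderivative
`-(1 + a u - b u ^ 2) exp (-a u - b u ^ 2 / 2)` of
`((a ^ 2 + 3 b) u - b ^ 2 u ^ 3) exp (-a u - b u ^ 2 / 2)`. -/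
theorem one_div_le_integral_mul_exp {a b : ℝ} (ha : 0 < a) (hb : 0 < b) :
    IntegrableOn (fun u => u * Real.exp (-(a * u) - b * u ^ 2 / 2)) (Set.Ioi 0) ∧
    1 / (a ^ 2 + 3 * b) ≤
      ∫ u in Set.Ioi 0, u * Real.exp (-(a * u) - b * u ^ 2 / 2) := by
  have hpow : ∀ k : ℕ, IntegrableOn
      (fun u : ℝ => u ^ k * Real.exp (-(a * u) - b * u ^ 2 / 2)) (Set.Ioi 0) := by
    intro k
    have h := integrable_rpow_mul_exp_neg_mul_sq (b := b / 2) (by positivity)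
      (s := k) (by have : (0 : ℝ) ≤ k := by positivity
                   linarith)
    refine Integrable.mono' h.integrableOn (by fun_prop) ?_
    filter_upwards [ae_restrict_mem measurableSet_Ioi] with u hu
    have hu : 0 < u := hu
    rw [Real.rpow_natCast, Real.norm_of_nonneg (by positivity)]
    have : 0 < a * u := by positivity
    gcongr
    linarith
  set F' : ℝ → ℝ := fun u => (a ^ 2 + 3 * b) * (u ^ 1 * Real.exp (-(a * u) - b * u ^ 2 / 2))
    - b ^ 2 * (u ^ 3 * Real.exp (-(a * u) - b * u ^ 2 / 2))
  have hF'int : IntegrableOn F' (Set.Ioi 0) := ((hpow 1).const_mul _).sub ((hpow 3).const_mul _)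
  have hderiv : ∀ u : ℝ, HasDerivAt
      (fun u => -((1 + a * u - b * u ^ 2) * Real.exp (-(a * u) - b * u ^ 2 / 2))) (F' u) u := by
    intro u
    have h1 : HasDerivAt (fun u : ℝ => -(a * u) - b * u ^ 2 / 2) (-a - b * u) u := by
      have := (((hasDerivAt_id u).const_mul a).neg).sub
        ((((hasDerivAt_id u).pow 2).const_mul b).div_const 2)
      refine this.congr_deriv ?_
      simp
      ring
    have h2 : HasDerivAt (fun u : ℝ => 1 + a * u - b * u ^ 2) (a - 2 * b * u) u := by
      have := (((hasDerivAt_id u).const_mul a).const_add 1).sub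
        (((hasDerivAt_id u).pow 2).const_mul b)
      refine this.congr_deriv ?_
      simp
      ring
    refine (h2.mul h1.exp).neg.congr_deriv ?_
    simp only [F']
    ring
  have htend : Filter.Tendsto
      (fun u => -((1 + a * u - b * u ^ 2) * Real.exp (-(a * u) - b * u ^ 2 / 2)))
      Filter.atTop (nhds 0) := by
    have hlin : Filter.Tendsto (fun u : ℝ => a * u) Filter.atTop Filter.atTop :=
      Filter.tendsto_id.const_mul_atTop ha
    have hk : ∀ k : ℕ, Filter.Tendsto (fun u : ℝ => (a * u) ^ k * Real.exp (-(a * u)))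
        Filter.atTop (nhds 0) := fun k =>
      (Real.tendsto_pow_mul_exp_neg_atTop_nhds_zero k).comp hlin
    have hbound : Filter.Tendsto (fun u : ℝ => (a * u) ^ 0 * Real.exp (-(a * u))
        + (a * u) ^ 1 * Real.exp (-(a * u))
        + b / a ^ 2 * ((a * u) ^ 2 * Real.exp (-(a * u)))) Filter.atTop (nhds 0) := by
      simpa using ((hk 0).add (hk 1)).add ((hk 2).const_mul (b / a ^ 2))
    refine squeeze_zero_norm' ?_ hbound
    filter_upwards [Filter.eventually_gt_atTop 0] with u hu
    have e : (a * u) ^ 0 * Real.exp (-(a * u)) + (a * u) ^ 1 * Real.exp (-(a * u))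
        + b / a ^ 2 * ((a * u) ^ 2 * Real.exp (-(a * u)))
        = (1 + a * u + b * u ^ 2) * Real.exp (-(a * u)) := by
      field_simp
    rw [e, norm_neg, norm_mul, Real.norm_of_nonneg (Real.exp_pos _).le, Real.norm_eq_abs]
    have h1 : 0 < a * u := by positivity
    have h2 : 0 < b * u ^ 2 := by positivity
    gcongr
    · exact abs_le.2 ⟨by linarith, by linarith⟩
    · linarith
  have hint := integral_Ioi_of_hasDerivAt_of_tendsto'
    (fun u (_ : u ∈ Set.Ici (0 : ℝ)) => hderiv u) hF'int htend
  have h1 := hpow 1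
  simp only [pow_one] at h1
  refine ⟨h1, ?_⟩
  rw [div_le_iff₀' (by positivity), ← integral_const_mul]
  have : (1 : ℝ) = ∫ u in Set.Ioi 0, F' u := by simp [hint]
  rw [this]
  refine setIntegral_mono_on hF'int (h1.const_mul _) measurableSet_Ioi fun u hu => ?_
  have hu : 0 < u := hu
  simp only [F', pow_one]
  have : 0 < b ^ 2 * (u ^ 3 * Real.exp (-(a * u) - b * u ^ 2 / 2)) := by positivity
  linarith

/-- Jensen's inequality for `x ↦ 1 / x`, via the tangent line at the mean `A + T ^ 2`. -/
theorem div_le_integral_one_div {A T : ℝ} (hA : 0 < A) (hT : 0 < T) :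
    2 * T / (A + T ^ 2) ≤ ∫ w in Set.Icc (-T) T, 1 / (A + 3 * w ^ 2) := by
  rw [integral_Icc_eq_integral_Ioc, ← intervalIntegral.integral_of_le (by linarith)]
  set m := A + T ^ 2 with hm
  have hm0 : 0 < m := by positivity
  have h : ∫ w in (-T)..T, (2 / m - A / m ^ 2 - 3 / m ^ 2 * w ^ 2) = 2 * T / m := by
    rw [intervalIntegral.integral_sub (by simp)
      (Continuous.intervalIntegrable (by fun_prop) _ _), intervalIntegral.integral_const,
      intervalIntegral.integral_const_mul, integral_pow]
    simp only [smul_eq_mul]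
    field_simp
    rw [hm]
    ring
  rw [← h]
  have hpos : ∀ w : ℝ, 0 < A + 3 * w ^ 2 := fun w => by positivity
  refine intervalIntegral.integral_mono_on (by linarith)
    (Continuous.intervalIntegrable (by fun_prop) _ _)
    (Continuous.intervalIntegrable
      (continuous_const.div (by fun_prop) fun w => (hpos w).ne') _ _) fun w _ => ?_
  rw [le_div_iff₀ (hpos w)]
  have : (2 / m - A / m ^ 2 - 3 / m ^ 2 * w ^ 2) * (A + 3 * w ^ 2)
      = 1 - ((A + 3 * w ^ 2) / m - 1) ^ 2 := by
    field_simp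
    ring
  rw [this]
  nlinarith [sq_nonneg ((A + 3 * w ^ 2) / m - 1)]

theorem gaussianReal_Icc_neg_mul_mul {u T : ℝ} (hu : 0 < u) :
    gaussianReal 0 1 (Set.Icc (-(u * T)) (u * T)) =
      ∫⁻ w in Set.Icc (-T) T, ENNReal.ofReal (u * gaussianPDFReal 0 1 (u * w)) := by
  have himage : (fun w => u * w) '' Set.Icc (-T) T = Set.Icc (-(u * T)) (u * T) := by
    rw [Set.image_mul_left_Icc' hu, mul_neg]
  rw [gaussianReal_apply _ one_ne_zero, ← himage,
    lintegral_image_eq_lintegral_abs_deriv_mul measurableSet_Icc (f' := fun _ => u)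
      (fun w _ => by simpa using ((hasDerivAt_id w).const_mul u).hasDerivWithinAt)
      (mul_right_injective₀ hu.ne').injOn]
  simp_rw [abs_of_pos hu, gaussianPDF_def, ENNReal.ofReal_mul hu.le]

theorem gaussianPDFReal_add_mul_mul_gaussianPDFReal (a u w : ℝ) :
    gaussianPDFReal 0 1 (a + u) * (u * gaussianPDFReal 0 1 (u * w)) =
      Real.exp (-a ^ 2 / 2) / (2 * Real.pi) *
        (u * Real.exp (-(a * u) - (1 + w ^ 2) * u ^ 2 / 2)) := by
  have hsq : (√(2 * Real.pi))⁻¹ * (√(2 * Real.pi))⁻¹ = (2 * Real.pi)⁻¹ := by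
    rw [← mul_inv, Real.mul_self_sqrt (by positivity)]
  have hexp : Real.exp (-(a + u) ^ 2 / 2) * Real.exp (-(u * w) ^ 2 / 2) =
      Real.exp (-a ^ 2 / 2) * Real.exp (-(a * u) - (1 + w ^ 2) * u ^ 2 / 2) := by
    rw [← Real.exp_add, ← Real.exp_add]
    ring_nf
  simp only [gaussianPDFReal, NNReal.coe_one, mul_one, sub_zero]
  rw [div_eq_mul_inv _ (2 * Real.pi), ← hsq]
  linear_combination (√(2 * Real.pi))⁻¹ * (√(2 * Real.pi))⁻¹ * u * hexp

/-- Lower bound for the Gaussian measure of a planar wedge with apex `(a, 0)`, in the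
coordinates `(a + u, u * w)`. -/
theorem le_gaussianReal_prod_wedge {a T : ℝ} (ha : 0 < a) (hT : 0 < T) :
    ENNReal.ofReal (Real.exp (-a ^ 2 / 2) / (2 * Real.pi) * (2 * T / (a ^ 2 + 3 + T ^ 2))) ≤
      (gaussianReal 0 1).prod (gaussianReal 0 1) {z : ℝ × ℝ | |z.2| ≤ (z.1 - a) * T} := by
  set C := Real.exp (-a ^ 2 / 2) / (2 * Real.pi) with hC
  have hC0 : 0 < C := by positivity
  set W : Set (ℝ × ℝ) := {z | |z.2| ≤ (z.1 - a) * T}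
  have hW : MeasurableSet W := measurableSet_le (by fun_prop) (by fun_prop)
  have hslice : Measurable fun x => gaussianReal 0 1 (Prod.mk x ⁻¹' W) :=
    measurable_measure_prodMk_left hW
  calc ENNReal.ofReal (C * (2 * T / (a ^ 2 + 3 + T ^ 2)))
      ≤ ENNReal.ofReal (C * ∫ w in Set.Icc (-T) T, 1 / (a ^ 2 + 3 + 3 * w ^ 2)) := by
        gcongr
        exact div_le_integral_one_div (by positivity) hT
    _ = ∫⁻ w in Set.Icc (-T) T, ENNReal.ofReal (C * (1 / (a ^ 2 + 3 + 3 * w ^ 2))) := by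
        rw [← integral_const_mul, ofReal_integral_eq_lintegral_ofReal]
        · refine (Continuous.integrableOn_Icc ?_)
          exact continuous_const.mul (continuous_const.div (by fun_prop) fun w => by positivity)
        · exact ae_of_all _ fun w => by positivity
    _ ≤ ∫⁻ w in Set.Icc (-T) T, ∫⁻ u in Set.Ioi 0, ENNReal.ofReal
          (C * (u * Real.exp (-(a * u) - (1 + w ^ 2) * u ^ 2 / 2))) := by
        refine lintegral_mono fun w => ?_
        obtain ⟨hint, hle⟩ := one_div_le_integral_mul_exp ha (b := 1 + w ^ 2) (by positivity)
        rw [← ofReal_integral_eq_lintegral_ofReal (hint.const_mul C), integral_const_mul]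
        · gcongr
          exact le_of_eq_of_le (by ring) hle
        · filter_upwards [ae_restrict_mem measurableSet_Ioi] with u hu
          have hu : 0 < u := hu
          positivity
    _ = ∫⁻ u in Set.Ioi 0, ∫⁻ w in Set.Icc (-T) T, ENNReal.ofReal
          (C * (u * Real.exp (-(a * u) - (1 + w ^ 2) * u ^ 2 / 2))) :=
        lintegral_lintegral_swap (by fun_prop)
    _ = ∫⁻ u in Set.Ioi 0, gaussianPDF 0 1 (a + u) *
          gaussianReal 0 1 (Prod.mk (a + u) ⁻¹' W) := by
        refine setLIntegral_congr_fun measurableSet_Ioi fun u hu => ?_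
        have hpre : Prod.mk (a + u) ⁻¹' W = Set.Icc (-(u * T)) (u * T) := by
          ext y
          simp [W, abs_le]
        rw [hpre, gaussianReal_Icc_neg_mul_mul hu, ← lintegral_const_mul _ (by fun_prop)]
        simp_rw [gaussianPDF_def, ← ENNReal.ofReal_mul (gaussianPDFReal_nonneg 0 1 _),
          gaussianPDFReal_add_mul_mul_gaussianPDFReal, hC]
    _ ≤ ∫⁻ u, gaussianPDF 0 1 (a + u) * gaussianReal 0 1 (Prod.mk (a + u) ⁻¹' W) :=
        setLIntegral_le_lintegral _ _
    _ = ∫⁻ x, gaussianPDF 0 1 x * gaussianReal 0 1 (Prod.mk x ⁻¹' W) :=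
        lintegral_add_left_eq_self
          (fun x => gaussianPDF 0 1 x * gaussianReal 0 1 (Prod.mk x ⁻¹' W)) a
    _ = (gaussianReal 0 1).prod (gaussianReal 0 1) W := by
        rw [Measure.prod_apply hW]
        generalize hg : (fun x => gaussianReal 0 1 (Prod.mk x ⁻¹' W)) = g at hslice
        simp_rw [funext_iff] at hg
        simp_rw [hg, gaussianReal_of_var_ne_zero 0 one_ne_zero,
          lintegral_withDensity_eq_lintegral_mul _ (measurable_gaussianPDF 0 1) hslice,
          Pi.mul_apply]

theorem stmt_19 (n : ℕ) (hn : 2 ≤ n) (c : ℝ) (hc : 0 < c) (β : ℝ)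
    (hβ : β ∈ Set.Ioo 0 (Real.pi / 2))
    (v₁ v₂ : Fin n → ℝ)
    (hv₁ : ∑ i, (v₁ i) ^ 2 = 1) (hv₂ : ∑ i, (v₂ i) ^ 2 = 1)
    (hv : ∑ i, v₁ i * v₂ i = -Real.cos (2 * β)) :
    (Real.sin β ^ 3 / (Real.pi * Real.cos β)) / (c ^ 2 + 2 * Real.sin β ^ 2 + Real.tan β ^ 2)
        * Real.exp (-(c ^ 2) / (2 * Real.sin β ^ 2))
      ≤ ((Measure.pi fun _ : Fin n => gaussianReal 0 1)
          {r | c ≤ ∑ i, v₁ i * r i ∧ c ≤ ∑ i, v₂ i * r i}).toReal := by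
  obtain ⟨hβ0, hβ1⟩ := hβ
  have hs : 0 < Real.sin β := Real.sin_pos_of_pos_of_lt_pi hβ0 (by linarith [Real.pi_pos])
  have hk : 0 < Real.cos β := Real.cos_pos_of_mem_Ioo ⟨by linarith, hβ1⟩
  have hsk := Real.sin_sq_add_cos_sq β
  rw [Real.cos_two_mul] at hv
  rw [Real.tan_eq_sin_div_cos]
  set s := Real.sin β
  set k := Real.cos β
  set e₁ : Fin n → ℝ := fun i => (v₁ i + v₂ i) / (2 * s) with he₁
  set e₂ : Fin n → ℝ := fun i => (v₁ i - v₂ i) / (2 * k) with he₂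
  have h₁ : ∑ i, e₁ i ^ 2 = 1 := by
    have (i : Fin n) : e₁ i ^ 2 = (v₁ i ^ 2 + 2 * (v₁ i * v₂ i) + v₂ i ^ 2) / (4 * s ^ 2) := by
      simp only [he₁]
      ring
    simp_rw [this, ← Finset.sum_div, Finset.sum_add_distrib, ← Finset.mul_sum, hv₁, hv₂, hv]
    rw [div_eq_one_iff_eq (by positivity)]
    linear_combination -4 * hsk
  have h₂ : ∑ i, e₂ i ^ 2 = 1 := by
    have (i : Fin n) : e₂ i ^ 2 = (v₁ i ^ 2 - 2 * (v₁ i * v₂ i) + v₂ i ^ 2) / (4 * k ^ 2) := by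
      simp only [he₂]
      ring
    simp_rw [this, ← Finset.sum_div, Finset.sum_add_distrib, Finset.sum_sub_distrib,
      ← Finset.mul_sum, hv₁, hv₂, hv]
    rw [div_eq_one_iff_eq (by positivity)]
    ring
  have h₁₂ : ∑ i, e₁ i * e₂ i = 0 := by
    have (i : Fin n) : e₁ i * e₂ i = (v₁ i ^ 2 - v₂ i ^ 2) / (4 * s * k) := by
      simp only [he₁, he₂]
      field_simp
      ring
    simp_rw [this, ← Finset.sum_div, Finset.sum_sub_distrib, hv₁, hv₂]
    simp
  have hset : {r : Fin n → ℝ | c ≤ ∑ i, v₁ i * r i ∧ c ≤ ∑ i, v₂ i * r i} =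
      (fun r => (∑ i, e₁ i * r i, ∑ i, e₂ i * r i)) ⁻¹'
        {z : ℝ × ℝ | |z.2| ≤ (z.1 - c / s) * (s / k)} := by
    ext r
    have hx : ∑ i, v₁ i * r i = s * ∑ i, e₁ i * r i + k * ∑ i, e₂ i * r i := by
      rw [Finset.mul_sum, Finset.mul_sum, ← Finset.sum_add_distrib]
      refine Finset.sum_congr rfl fun i _ => ?_
      simp only [he₁, he₂]
      field_simp
      ring
    have hy : ∑ i, v₂ i * r i = s * ∑ i, e₁ i * r i - k * ∑ i, e₂ i * r i := by
      rw [Finset.mul_sum, Finset.mul_sum, ← Finset.sum_sub_distrib]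
      refine Finset.sum_congr rfl fun i _ => ?_
      simp only [he₁, he₂]
      field_simp
      ring
    have hz (x : ℝ) : (x - c / s) * (s / k) = (s * x - c) / k := by field_simp
    simp only [Set.mem_ofPred_eq, Set.mem_preimage, hx, hy, hz, abs_le]
    rw [← neg_div, div_le_iff₀ hk, le_div_iff₀ hk]
    constructor <;> rintro ⟨_, _⟩ <;> constructor <;> linarith
  have hwedge := le_gaussianReal_prod_wedge (div_pos hc hs) (div_pos hs hk)
  rw [← map_pi_gaussianReal_orthonormal_pair e₁ e₂ h₁ h₂ h₁₂, Measure.map_apply (by fun_prop)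
    (measurableSet_le (by fun_prop) (by fun_prop)), ← hset] at hwedge
  have hreal := (ENNReal.ofReal_le_iff_le_toReal (measure_ne_top _ _)).1 hwedge
  refine le_of_eq_of_le ?_ hreal
  have hexp : -(c / s) ^ 2 / 2 = -(c ^ 2) / (2 * s ^ 2) := by field_simp
  have hden : c ^ 2 + 2 * s ^ 2 + (s / k) ^ 2 = s ^ 2 * ((c / s) ^ 2 + 3 + (s / k) ^ 2) := by
    field_simp
    linear_combination -(s ^ 2) * hsk
  rw [hexp, hden]
  field_simp
end
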